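/- arXiv:1709.00204 — 6 statements merged into one kernel-verified Lean document; each statement's English description precedes it below -/
import Mathlib

section
/- Let f be a Gaussian stationary process on T ∈ {ℤ, ℝ} with spectral measure ρ satisfying m₀ = 1 and m_δ < ∞ for some δ > 0, and assume ρ has a nontrivial absolutely continuous component (there exist ν > 0 and a bounded measurable set E ⊆ T* of positive Lebesgue measure with dρ ≥ ν·1_E(λ) dλ). For N > 0 for which the set {k ∈ ℕ : 0 < k ≤ N and k·m_{−2k}^{1/k} ≤ N} is nonempty, let k(N) be its maximum. Then there exist positive constants C, c (depending on ρ) and N₀ such that for all N > N₀ for which k(N) is defined: log P_f(N) ≤ −C·N·k(N)·log(cN/k(N)). -/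
open MeasureTheory ProbabilityTheory Real Set
open scoped ENNReal NNReal

noncomputable section

/-- The `d`-th absolute spectral moment `m_d(ρ) = ∫ |λ|^d dρ(λ)`, valued in `[0,∞]`. -/
def specMom (ρ : Measure ℝ) (d : ℝ) : ℝ≥0∞ := ∫⁻ l, (ENNReal.ofReal |l|) ^ d ∂ρ

/-- `σ_N² = ρ([0, 1/N])`. -/
def sig2 (ρ : Measure ℝ) (N : ℝ) : ℝ := (ρ (Set.Icc 0 (1/N))).toReal

/-- `f` is a Gaussian stationary process on `ℝ` with spectral measure `ρ`, on the
probability space `(Ω, P)`: `ρ` is finite, symmetric and nonnegative; paths are a.s.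
continuous; and every finite linear combination `∑ aᵢ f(tᵢ)` is a centered Gaussian with
variance `∑ᵢⱼ aᵢ aⱼ r(tᵢ - tⱼ)` where `r(t) = ∫ cos(λ t) dρ(λ)`. -/
def IsGSPR {Ω : Type*} [MeasurableSpace Ω] (ρ : Measure ℝ) (P : Measure Ω)
    (f : ℝ → Ω → ℝ) : Prop :=
  IsFiniteMeasure ρ ∧ ρ.map (fun x => -x) = ρ ∧ IsProbabilityMeasure P ∧
  Measurable (fun p : ℝ × Ω => f p.1 p.2) ∧
  (∀ᵐ ω ∂P, Continuous fun t => f t ω) ∧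
  ∀ (n : ℕ) (t a : Fin n → ℝ),
    P.map (fun ω => ∑ i, a i * f (t i) ω)
      = gaussianReal 0 (∑ i, ∑ j, a i * a j * ∫ l, Real.cos (l * (t i - t j)) ∂ρ).toNNReal

/-- `f` is a Gaussian stationary process on `ℤ` with spectral measure `ρ` (supported on
`[-π,π]`), on the probability space `(Ω, P)`. -/
def IsGSPZ {Ω : Type*} [MeasurableSpace Ω] (ρ : Measure ℝ) (P : Measure Ω)
    (f : ℤ → Ω → ℝ) : Prop :=
  IsFiniteMeasure ρ ∧ ρ.map (fun x => -x) = ρ ∧ ρ (Set.Icc (-Real.pi) Real.pi)ᶜ = 0 ∧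
  IsProbabilityMeasure P ∧ (∀ n : ℤ, Measurable (f n)) ∧
  ∀ (n : ℕ) (t : Fin n → ℤ) (a : Fin n → ℝ),
    P.map (fun ω => ∑ i, a i * f (t i) ω)
      = gaussianReal 0
          (∑ i, ∑ j, a i * a j * ∫ l, Real.cos (l * ((t i : ℝ) - (t j : ℝ))) ∂ρ).toNNReal

/-- Persistence probability `P_f(N) = ℙ(f(t) > 0 ∀ t ∈ (0,N])` for a process on `ℝ`. -/
def persR {Ω : Type*} [MeasurableSpace Ω] (P : Measure Ω) (f : ℝ → Ω → ℝ) (N : ℝ) : ℝ :=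
  (P {ω | ∀ t ∈ Set.Ioc (0:ℝ) N, 0 < f t ω}).toReal

/-- Persistence probability `P_f(N) = ℙ(f(n) > 0 ∀ n ∈ (0,N] ∩ ℤ)` for a process on `ℤ`. -/
def persZ {Ω : Type*} [MeasurableSpace Ω] (P : Measure Ω) (f : ℤ → Ω → ℝ) (N : ℝ) : ℝ :=
  (P {ω | ∀ n : ℤ, 0 < n → (n : ℝ) ≤ N → 0 < f n ω}).toReal

/-- The standard Gaussian measure on `ℝ` (law of `Z ~ N(0,1)`). -/
def stdGauss : Measure ℝ := gaussianReal 0 1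


lemma gauss_sq (t : ℝ) (ht : 0 ≤ t) :
    ∫ x, rexp (-(t * x ^ 2)) ∂(gaussianReal 0 1) = (1 + 2 * t) ^ (-(1/2) : ℝ) := by
  rw [integral_gaussianReal_eq_integral_smul (by norm_num)]
  have h : ∀ x : ℝ, gaussianPDFReal 0 1 x • rexp (-(t * x ^ 2))
      = (√(2 * π))⁻¹ * rexp (-(t + 1/2) * x ^ 2) := by
    intro x
    simp only [gaussianPDFReal, NNReal.coe_one, mul_one, sub_zero, smul_eq_mul]
    rw [mul_assoc, ← Real.exp_add]; congr 2; ring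
  simp_rw [h]
  rw [integral_const_mul, integral_gaussian, ← Real.sqrt_inv, ← Real.sqrt_mul (by positivity),
    Real.rpow_neg (by positivity), ← Real.sqrt_eq_rpow, ← Real.sqrt_inv]
  congr 1
  field_simp
  ring

lemma gauss_quad {ι : Type*} [Fintype ι] [DecidableEq ι] (B : Matrix ι ι ℝ) (hB : B.IsHermitian)
    (D : ℝ) (hD : 0 < D) (h0 : ∀ x : ι → ℝ, 0 ≤ x ⬝ᵥ (B.mulVec x))
    (h1 : ∀ x : ι → ℝ, x ⬝ᵥ (B.mulVec x) ≤ D * ∑ i, x i ^ 2) (t : ℝ) (ht : 0 ≤ t) :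
    ∫ x, rexp (-(t * (x.ofLp ⬝ᵥ (B.mulVec x.ofLp)))) ∂(stdGaussian (EuclideanSpace ℝ ι))
      ≤ (1 + 2 * t * D) ^ (-(B.trace / (2 * D))) := by
  set b := hB.eigenvectorBasis with hb
  set m := hB.eigenvalues with hm
  have hquad : ∀ x : ι → ℝ, ((∑ i, x i • b i : EuclideanSpace ℝ ι).ofLp ⬝ᵥ
      (B.mulVec (∑ i, x i • b i : EuclideanSpace ℝ ι).ofLp)) = ∑ i, m i * x i ^ 2 := by
    intro x
    have e1 : B.mulVec (∑ i, x i • b i : EuclideanSpace ℝ ι).ofLp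
        = (∑ i, (m i * x i) • b i : EuclideanSpace ℝ ι).ofLp := by
      have : (∑ i, x i • b i : EuclideanSpace ℝ ι).ofLp = ∑ i, x i • (b i).ofLp := by
        simp
      rw [this, Matrix.mulVec_sum]
      simp only [Matrix.mulVec_smul, hb, hB.mulVec_eigenvectorBasis]
      simp [smul_smul, mul_comm, hm]
    rw [e1]
    have e2 : ∀ u v : EuclideanSpace ℝ ι, u.ofLp ⬝ᵥ v.ofLp = inner ℝ u v := by
      intro u v
      simp [PiLp.inner_apply, dotProduct, mul_comm]
    rw [e2, ← b.sum_inner_mul_inner]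
    apply Finset.sum_congr rfl
    intro i _
    have o : ∀ y : ι → ℝ, inner ℝ (b i) (∑ k, y k • b k) = y i := by
      intro y
      simp [inner_sum, inner_smul_right, b.inner_eq_ite]
    rw [real_inner_comm, o, o]; ring
  have hm0 : ∀ i, 0 ≤ m i := by
    intro i
    have := h0 (∑ k, (Pi.single i (1:ℝ) : ι → ℝ) k • b k : EuclideanSpace ℝ ι).ofLp
    rw [hquad] at this
    simpa [Pi.single_apply] using this
  have hmD : ∀ i, m i ≤ D := by
    intro i
    have := h1 (∑ k, (Pi.single i (1:ℝ) : ι → ℝ) k • b k : EuclideanSpace ℝ ι).ofLp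
    rw [hquad, ← EuclideanSpace.real_norm_sq_eq] at this
    simpa [Pi.single_apply] using this
  rw [stdGaussian_eq_map_pi_orthonormalBasis b, integral_map (Continuous.aemeasurable (by fun_prop))]
  swap
  · apply Continuous.aestronglyMeasurable
    simp only [dotProduct, Matrix.mulVec]
    fun_prop
  simp_rw [hquad]
  have e3 : ∀ x : ι → ℝ, rexp (-(t * ∑ i, m i * x i ^ 2)) = ∏ i, rexp (-((t * m i) * x i ^ 2)) := by
    intro x
    rw [← Real.exp_sum, Finset.mul_sum, Finset.sum_neg_distrib]
    simp [mul_assoc]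
  simp_rw [e3]
  rw [integral_fintype_prod_eq_prod (fun i (y : ℝ) => rexp (-((t * m i) * y ^ 2)))]
  have e4 : (1 + 2 * t * D) ^ (-(B.trace / (2 * D))) = ∏ i, (1 + 2 * t * D) ^ (-(m i / (2 * D))) := by
    rw [← Real.rpow_sum_of_pos (by positivity), hB.trace_eq_sum_eigenvalues]
    congr 1
    simp [Finset.sum_div, hm]
  rw [e4]
  apply Finset.prod_le_prod
  · intro i _; positivity
  · intro i _
    rw [gauss_sq _ (mul_nonneg ht (hm0 i))]
    have b1 := rpow_one_add_le_one_add_mul_self (s := 2 * t * D) (p := m i / D)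
      (by have : 0 ≤ 2 * t * D := by positivity
          linarith) (div_nonneg (hm0 i) hD.le) ((div_le_one hD).2 (hmD i))
    have b2 : m i / D * (2 * t * D) = 2 * (t * m i) := by field_simp
    rw [b2] at b1
    calc _ ≤ ((1 + 2 * t * D) ^ (m i / D)) ^ (-(1/2):ℝ) := by
          apply Real.rpow_le_rpow_of_nonpos (by positivity) b1 (by norm_num)
      _ = _ := by
          rw [← Real.rpow_mul (by positivity)]; congr 1; field_simp

def qf {ι : Type*} (τ : ι → ℝ) (s : Finset ι) (a : ι → ℝ) (l : ℝ) : ℝ :=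
  (∑ j ∈ s, a j * cos (l * τ j)) ^ 2 + (∑ j ∈ s, a j * sin (l * τ j)) ^ 2

lemma qf_nonneg {ι : Type*} (τ : ι → ℝ) (s : Finset ι) (a : ι → ℝ) (l : ℝ) : 0 ≤ qf τ s a l := by
  unfold qf; positivity

lemma qf_cont {ι : Type*} (τ : ι → ℝ) (s : Finset ι) (a : ι → ℝ) : Continuous (qf τ s a) := by
  unfold qf; fun_prop

lemma qf_eq {ι : Type*} (τ : ι → ℝ) (s : Finset ι) (a : ι → ℝ) (l : ℝ) :
    qf τ s a l = ∑ i ∈ s, ∑ j ∈ s, a i * a j * cos (l * (τ i - τ j)) := by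
  unfold qf
  rw [sq, sq, Finset.sum_mul_sum, Finset.sum_mul_sum, ← Finset.sum_add_distrib]
  apply Finset.sum_congr rfl
  intro i _
  rw [← Finset.sum_add_distrib]
  apply Finset.sum_congr rfl
  intro j _
  rw [mul_sub, Real.cos_sub]; ring

lemma qf_bdd {ι : Type*} (τ : ι → ℝ) (s : Finset ι) (a : ι → ℝ) (l : ℝ) :
    qf τ s a l ≤ 2 * (∑ j ∈ s, |a j|) ^ 2 := by
  unfold qf
  have h1 : |∑ j ∈ s, a j * cos (l * τ j)| ≤ ∑ j ∈ s, |a j| := by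
    refine (Finset.abs_sum_le_sum_abs _ _).trans (Finset.sum_le_sum fun j _ => ?_)
    rw [abs_mul]; exact mul_le_of_le_one_right (abs_nonneg _) (abs_cos_le_one _)
  have h2 : |∑ j ∈ s, a j * sin (l * τ j)| ≤ ∑ j ∈ s, |a j| := by
    refine (Finset.abs_sum_le_sum_abs _ _).trans (Finset.sum_le_sum fun j _ => ?_)
    rw [abs_mul]; exact mul_le_of_le_one_right (abs_nonneg _) (abs_sin_le_one _)
  have h3 := sq_le_sq' (abs_le.1 h1).1 (abs_le.1 h1).2
  have h4 := sq_le_sq' (abs_le.1 h2).1 (abs_le.1 h2).2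
  linarith

lemma integrable_cosmul (ρ : Measure ℝ) [IsFiniteMeasure ρ] (t : ℝ) :
    Integrable (fun l => cos (l * t)) ρ :=
  Integrable.of_bound (Continuous.aestronglyMeasurable (by fun_prop)) 1
    (Filter.Eventually.of_forall fun l => by simpa using abs_cos_le_one _)

lemma qf_integrable {ι : Type*} (τ : ι → ℝ) (s : Finset ι) (a : ι → ℝ) (ρ : Measure ℝ)
    [IsFiniteMeasure ρ] : Integrable (qf τ s a) ρ :=
  Integrable.of_bound (qf_cont _ _ _).aestronglyMeasurable (2 * (∑ j ∈ s, |a j|) ^ 2)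
    (Filter.Eventually.of_forall fun l => by
      rw [Real.norm_eq_abs, abs_of_nonneg (qf_nonneg _ _ _ _)]; exact qf_bdd _ _ _ _)

lemma qf_integral {ι : Type*} (τ : ι → ℝ) (s : Finset ι) (a : ι → ℝ) (ρ : Measure ℝ)
    [IsFiniteMeasure ρ] :
    ∫ l, qf τ s a l ∂ρ = ∑ i ∈ s, ∑ j ∈ s, a i * a j * ∫ l, cos (l * (τ i - τ j)) ∂ρ := by
  simp_rw [qf_eq]
  rw [integral_finsetSum _ fun i _ => integrable_finsetSum _ fun j _ =>
    (integrable_cosmul ρ _).const_mul _]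
  refine Finset.sum_congr rfl fun i _ => ?_
  rw [integral_finsetSum _ fun j _ => (integrable_cosmul ρ _).const_mul _]
  simp_rw [integral_const_mul]

structure HG {Ω ι : Type*} [MeasurableSpace Ω] (ρ : Measure ℝ) (P : Measure Ω)
    (h : ι → Ω → ℝ) (τ : ι → ℝ) : Prop where
  meas : ∀ i, Measurable (h i)
  law : ∀ (s : Finset ι) (a : ι → ℝ), P.map (fun ω => ∑ j ∈ s, a j * h j ω)
    = gaussianReal 0 (∫ l, qf τ s a l ∂ρ).toNNReal

lemma HG_of {Ω ι₀ ι : Type*} [MeasurableSpace Ω] (ρ : Measure ℝ) [IsFiniteMeasure ρ]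
    (P : Measure Ω) (f : ι₀ → Ω → ℝ) (τ : ι₀ → ℝ) (hm : ∀ i, Measurable (f i))
    (H : ∀ (n : ℕ) (t : Fin n → ι₀) (a : Fin n → ℝ),
      P.map (fun ω => ∑ i, a i * f (t i) ω)
      = gaussianReal 0 (∑ i, ∑ j, a i * a j * ∫ l, Real.cos (l * (τ (t i) - τ (t j))) ∂ρ).toNNReal)
    (g : ι → ι₀) : HG ρ P (fun i => f (g i)) (fun i => τ (g i)) := by
  refine ⟨fun i => hm _, fun s a => ?_⟩
  have key : ∀ F : ι → ℝ, ∑ i : Fin s.card, F (s.equivFin.symm i) = ∑ j ∈ s, F j := by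
    intro F
    rw [s.equivFin.symm.sum_comp (fun x : s => F x), Finset.sum_coe_sort]
  have := H s.card (fun i => g (s.equivFin.symm i)) (fun i => a (s.equivFin.symm i))
  simp_rw [qf_integral]
  simp_rw [← key]
  exact this

lemma HG.comp {Ω ι₀ ι : Type*} [MeasurableSpace Ω] {ρ : Measure ℝ}
    {P : Measure Ω} {f : ι₀ → Ω → ℝ} {τ : ι₀ → ℝ} (H : HG ρ P f τ) (g : ι ↪ ι₀) :
    HG ρ P (fun i => f (g i)) (fun i => τ (g i)) := by
  classical
  refine ⟨fun i => H.meas _, fun s a => ?_⟩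
  have := H.law (s.map g) (Function.extend g a 0)
  simpa [Finset.sum_map, qf, g.injective.extend_apply] using this

lemma HG_sq {Ω ι : Type*} [Fintype ι] [MeasurableSpace Ω] {ρ : Measure ℝ} [IsFiniteMeasure ρ]
    {P : Measure Ω} [IsProbabilityMeasure P] {h : ι → Ω → ℝ} {τ : ι → ℝ} (H : HG ρ P h τ)
    (s : ℝ) (hs : 0 ≤ s) :
    ∫ ω, rexp (-(s * ∑ j, h j ω ^ 2)) ∂P
      = ∫ z, rexp (-(s * ∫ l, qf τ Finset.univ z.ofLp l ∂ρ)) ∂(stdGaussian (EuclideanSpace ℝ ι)) := by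
  set c := √(2 * s) with hc
  have hc2 : c ^ 2 = 2 * s := Real.sq_sqrt (by positivity)
  have hmeas := H.meas
  let F : Ω → EuclideanSpace ℝ ι → ℂ := fun ω z => Complex.exp (((c * ∑ j, z j * h j ω : ℝ) : ℂ) * Complex.I)
  have e1 : ∀ ω, ∫ z, F ω z ∂(stdGaussian (EuclideanSpace ℝ ι)) = ((rexp (-(s * ∑ j, h j ω ^ 2)) : ℝ) : ℂ) := by
    intro ω
    have := charFun_stdGaussian (WithLp.toLp 2 (fun j => c * h j ω) : EuclideanSpace ℝ ι)
    rw [charFun_apply] at this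
    have e : ∀ z : EuclideanSpace ℝ ι, inner ℝ z (WithLp.toLp 2 (fun j => c * h j ω) : EuclideanSpace ℝ ι)
        = c * ∑ j, z j * h j ω := by
      intro z
      simp only [PiLp.inner_apply, Finset.mul_sum]
      refine Finset.sum_congr rfl fun j _ => ?_
      simp; ring
    simp_rw [e] at this
    rw [this, ← Complex.ofReal_pow, EuclideanSpace.real_norm_sq_eq, Complex.ofReal_exp]
    simp only [mul_pow, hc2, ← Finset.mul_sum]
    congr 1
    push_cast; ring
  have e2 : ∀ z : EuclideanSpace ℝ ι, ∫ ω, F ω z ∂P = ((rexp (-(s * ∫ l, qf τ Finset.univ z.ofLp l ∂ρ)) : ℝ) : ℂ) := by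
    intro z
    have h1 := H.law Finset.univ z.ofLp
    have h2 := congrArg (fun μ => charFun μ c) h1
    simp only [charFun_gaussianReal] at h2
    rw [charFun_apply_real, integral_map (by fun_prop) (by fun_prop)] at h2
    simp only [F]
    rw [Complex.ofReal_exp]
    push_cast at h2 ⊢
    rw [h2]
    congr 1
    rw [Real.coe_toNNReal _ (integral_nonneg fun l => qf_nonneg _ _ _ _)]
    have : (c : ℂ) ^ 2 = 2 * s := by exact_mod_cast hc2
    rw [this]; ring
  have e3 := integral_integral_swap (f := F) (μ := P) (ν := stdGaussian (EuclideanSpace ℝ ι)) ?_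
  · simp_rw [e1, e2] at e3
    rw [integral_complex_ofReal, integral_complex_ofReal] at e3
    exact_mod_cast e3
  · apply Integrable.of_bound (C := 1)
    · apply Measurable.aestronglyMeasurable
      simp only [F, Function.uncurry_def]
      fun_prop
    · refine Filter.Eventually.of_forall fun p => ?_
      simp only [F, Function.uncurry_def]
      rw [Complex.norm_exp_ofReal_mul_I]

lemma int_cos_full (R : ℕ) (k : ℤ) (hk : k ≠ 0) :
    ∫ l in Icc (-(π * R)) (π * R), cos (l * (k : ℝ)) = 0 := by
  have hk' : (k : ℝ) ≠ 0 := by exact_mod_cast hk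
  have hR : -(π * R) ≤ π * R := by have : 0 ≤ π * R := by positivity
                                   linarith
  rw [integral_Icc_eq_integral_Ioc, ← intervalIntegral.integral_of_le hR,
    intervalIntegral.integral_comp_mul_right _ hk']
  rw [integral_cos]
  have h1 : sin (π * R * k) = 0 := by
    have := Real.sin_int_mul_pi (R * k)
    push_cast at this
    rw [← this]; congr 1; ring
  have h2 : -(π * R) * k = -(π * R * k) := by ring
  rw [h2, Real.sin_neg, h1]; simp

lemma rho_ge {ρ : Measure ℝ} {ν : ℝ} {E : Set ℝ}
    (hE : MeasurableSet E)
    (hρ : ∀ A : Set ℝ, MeasurableSet A → ENNReal.ofReal ν * volume (A ∩ E) ≤ ρ A) :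
    ENNReal.ofReal ν • (volume.restrict E) ≤ ρ := by
  refine Measure.le_iff.2 fun A hA => ?_
  simpa [Measure.restrict_apply hA] using hρ A hA

lemma rho_int {ρ : Measure ℝ} [IsFiniteMeasure ρ] {ν : ℝ} (hν : 0 < ν) {E : Set ℝ}
    (hE : MeasurableSet E)
    (hρ : ∀ A : Set ℝ, MeasurableSet A → ENNReal.ofReal ν * volume (A ∩ E) ≤ ρ A)
    {q : ℝ → ℝ} (hq : Integrable q ρ) (hq0 : ∀ l, 0 ≤ q l) :
    ν * ∫ l in E, q l ≤ ∫ l, q l ∂ρ := by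
  have := integral_mono_measure (rho_ge hE hρ) (Filter.Eventually.of_forall hq0) hq
  rwa [integral_smul_measure, ENNReal.toReal_ofReal hν.le, smul_eq_mul] at this

lemma small_ball {Ω ι : Type*} [Fintype ι] [MeasurableSpace Ω] {ρ : Measure ℝ} [IsFiniteMeasure ρ]
    {P : Measure Ω} [IsProbabilityMeasure P] {h : ι → Ω → ℝ} {τ : ι → ℝ} (H : HG ρ P h τ)
    (hτ : ∀ i j, i ≠ j → ∃ k : ℤ, k ≠ 0 ∧ τ i - τ j = k)
    {ν : ℝ} (hν : 0 < ν) {E : Set ℝ} (hE : MeasurableSet E) {R : ℕ} (hR : 0 < R)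
    (hER : E ⊆ Icc (-(π * R)) (π * R))
    (hρ : ∀ A : Set ℝ, MeasurableSet A → ENNReal.ofReal ν * volume (A ∩ E) ≤ ρ A)
    {η : ℝ} (hη : 0 < η) :
    P.real {ω | ∀ i, |h i ω| ≤ η} ≤ rexp (Fintype.card ι) *
      (1 + 2 * (ν / η ^ 2) * (2 * π * R)) ^
        (-((Fintype.card ι * volume.real E) / (2 * (2 * π * R)))) := by
  classical
  have hEf : volume E ≠ ⊤ := ne_top_of_le_ne_top (by simp) (measure_mono hER)
  have : IsFiniteMeasure (volume.restrict E) := ⟨by simpa using hEf.lt_top⟩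
  set I := Icc (-(π * R)) (π * R) with hI
  let B : Matrix ι ι ℝ := fun i j => ∫ l in E, cos (l * (τ i - τ j))
  have hB : B.IsHermitian := by
    refine Matrix.IsHermitian.ext fun i j => ?_
    change star (∫ l in E, cos (l * (τ j - τ i))) = ∫ l in E, cos (l * (τ i - τ j))
    rw [star_trivial]
    refine integral_congr_ae (Filter.Eventually.of_forall fun l => ?_)
    simp only
    rw [← Real.cos_neg]; congr 1; ring
  have hq : ∀ x : ι → ℝ, x ⬝ᵥ (B.mulVec x) = ∫ l in E, qf τ Finset.univ x l := by
    intro x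
    rw [qf_integral]
    simp only [dotProduct, Matrix.mulVec, Finset.mul_sum, B]
    refine Finset.sum_congr rfl fun i _ => Finset.sum_congr rfl fun j _ => by ring
  have hD : (0:ℝ) < 2 * π * R := by positivity
  have hfull : ∀ x : ι → ℝ, ∫ l in I, qf τ Finset.univ x l = (2 * π * R) * ∑ i, x i ^ 2 := by
    intro x
    rw [qf_integral, Finset.mul_sum]
    refine Finset.sum_congr rfl fun i _ => ?_
    rw [Finset.sum_eq_single i]
    · simp [hI]
      rw [max_eq_left (by positivity)]
      ring
    · intro j _ hj
      obtain ⟨k, hk, hk'⟩ := hτ i j hj.symm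
      rw [hk', int_cos_full R k hk, mul_zero]
    · simp
  have hmain := gauss_quad B hB (2 * π * R) hD
    (fun x => by rw [hq]; exact integral_nonneg fun l => qf_nonneg _ _ _ _)
    (fun x => by
      rw [hq, ← hfull]
      exact setIntegral_mono_set (qf_integrable _ _ _ _)
        (Filter.Eventually.of_forall fun l => qf_nonneg _ _ _ _) hER.eventuallyLE)
    (ν / η ^ 2) (by positivity)
  have htr : B.trace = Fintype.card ι * volume.real E := by
    simp [Matrix.trace, B, Matrix.diag]
  rw [htr] at hmain
  have hmeas := H.meas
  set n := Fintype.card ι with hn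
  have h1 : P.real {ω | ∀ i, |h i ω| ≤ η} ≤ ∫ ω, rexp n * rexp (-((1 / η ^ 2) * ∑ j, h j ω ^ 2)) ∂P := by
    have hs : MeasurableSet {ω | ∀ i, |h i ω| ≤ η} := by
      simp only [Set.ofPred_forall]
      exact MeasurableSet.iInter fun i => measurableSet_le (by fun_prop) measurable_const
    rw [← integral_indicator_one hs]
    have hint : Integrable (fun ω => rexp n * rexp (-((1 / η ^ 2) * ∑ j, h j ω ^ 2))) P := by
      apply Integrable.const_mul
      apply Integrable.of_bound (C := 1) (Measurable.aestronglyMeasurable (by fun_prop))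
      refine Filter.Eventually.of_forall fun ω => ?_
      rw [Real.norm_eq_abs, Real.abs_exp, Real.exp_le_one_iff]
      have : 0 ≤ (1 / η ^ 2) * ∑ j, h j ω ^ 2 := by positivity
      linarith
    refine integral_mono ((integrable_const (1:ℝ)).indicator hs) hint fun ω => ?_
    by_cases hω : ω ∈ {ω | ∀ i, |h i ω| ≤ η}
    · rw [indicator_of_mem hω]
      simp only [Pi.one_apply]
      rw [← Real.exp_add, Real.one_le_exp_iff]
      have : ∑ j, h j ω ^ 2 ≤ n * η ^ 2 := by
        calc ∑ j, h j ω ^ 2 ≤ ∑ j : ι, η ^ 2 := Finset.sum_le_sum fun j _ => by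
              rw [← sq_abs]; exact pow_le_pow_left₀ (abs_nonneg _) (hω j) 2
          _ = _ := by simp [hn]
      have h2 : (1 / η ^ 2) * ∑ j, h j ω ^ 2 ≤ n := by
        rw [one_div, inv_mul_le_iff₀ (by positivity)]; linarith
      linarith
    · rw [indicator_of_notMem hω]; positivity
  refine h1.trans ?_
  rw [integral_const_mul]
  refine mul_le_mul_of_nonneg_left ?_ (by positivity)
  rw [HG_sq H _ (by positivity)]
  refine le_trans ?_ hmain
  refine integral_mono_of_nonneg (Filter.Eventually.of_forall fun z => by positivity) ?_
    (Filter.Eventually.of_forall fun z => ?_)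
  · apply Integrable.of_bound (C := 1)
    · apply Continuous.aestronglyMeasurable
      simp only [dotProduct, Matrix.mulVec]
      fun_prop
    · refine Filter.Eventually.of_forall fun z => ?_
      rw [Real.norm_eq_abs, Real.abs_exp, Real.exp_le_one_iff, hq]
      have : 0 ≤ ν / η ^ 2 * ∫ l in E, qf τ Finset.univ z.ofLp l := 
        mul_nonneg (by positivity) (integral_nonneg fun l => qf_nonneg _ _ _ _)
      linarith
  · simp only
    apply Real.exp_le_exp.2
    rw [hq]
    have := rho_int hν hE hρ (qf_integrable τ Finset.univ z.ofLp ρ) (qf_nonneg _ _ _)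
    have h3 := mul_le_mul_of_nonneg_left this (show 0 ≤ 1 / η ^ 2 by positivity)
    have h4 : ν / η ^ 2 * ∫ l in E, qf τ Finset.univ z.ofLp l = 1 / η ^ 2 * (ν * ∫ l in E, qf τ Finset.univ z.ofLp l) := by ring
    linarith

lemma coarse {Ω ι : Type*} [Fintype ι] [MeasurableSpace Ω] {ρ : Measure ℝ} [IsFiniteMeasure ρ]
    {P : Measure Ω} [IsProbabilityMeasure P] {h : ι → Ω → ℝ} {τ : ι → ℝ} (H : HG ρ P h τ)
    (hτ : ∀ i j, i ≠ j → ∃ k : ℤ, k ≠ 0 ∧ τ i - τ j = k)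
    {ν : ℝ} (hν : 0 < ν) {E : Set ℝ} (hE : MeasurableSet E) {R : ℕ} (hR : 0 < R)
    (hER : E ⊆ Icc (-(π * R)) (π * R))
    (hρ : ∀ A : Set ℝ, MeasurableSet A → ENNReal.ofReal ν * volume (A ∩ E) ≤ ρ A)
    {θ : ℝ} (hθ : 0 < θ) :
    P.real {ω | (∀ i, 0 < h i ω) ∧ ∑ i, h i ω ≤ Fintype.card ι * θ} ≤
      (2 * rexp 1) ^ (Fintype.card ι) *
      (θ ^ 2 / (π * R * ν)) ^ (Fintype.card ι * (volume.real E / (8 * π * R))) := by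
  classical
  set n := Fintype.card ι with hn
  set γ := volume.real E / (8 * π * R) with hγ
  have hγ0 : 0 ≤ γ := by positivity
  set b := rexp n * (θ ^ 2 / (π * R * ν)) ^ (n * γ) with hb
  have hJ : ∀ J : Finset ι, n ≤ 2 * J.card → P.real {ω | ∀ i ∈ J, |h i ω| ≤ 2 * θ} ≤ b := by
    intro J hJn
    have := small_ball (H.comp (Function.Embedding.subtype (· ∈ J)))
      (by intro i j hij
          exact hτ i j (fun h => hij (Subtype.ext h))) hν hE hR hER hρ (η := 2 * θ) (by positivity)
    have hcard : Fintype.card {x // x ∈ J} = J.card := by simp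
    rw [hcard] at this
    have e : {ω | ∀ i : {x // x ∈ J}, |h (Function.Embedding.subtype (· ∈ J) i) ω| ≤ 2 * θ} = {ω | ∀ i ∈ J, |h i ω| ≤ 2 * θ} := by
      ext ω; simp
    rw [e] at this
    refine this.trans ?_
    rw [hb]
    have hJn2 : J.card ≤ n := Finset.card_le_univ J
    refine mul_le_mul (Real.exp_le_exp.2 (by exact_mod_cast hJn2)) ?_ (by positivity) (by positivity)
    have hJr : (n : ℝ) ≤ 2 * J.card := by exact_mod_cast hJn
    set Q := 1 + 2 * (ν / (2 * θ) ^ 2) * (2 * π * R) with hQ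
    have hQ1 : 1 ≤ Q := by
      have : 0 ≤ 2 * (ν / (2 * θ) ^ 2) * (2 * π * R) := by positivity
      linarith
    calc Q ^ (-(J.card * volume.real E / (2 * (2 * π * R)))) ≤ Q ^ (-(n * γ)) := by
          apply Real.rpow_le_rpow_of_exponent_le hQ1
          have : J.card * volume.real E / (2 * (2 * π * R)) = 2 * J.card * γ := by
            rw [hγ]; field_simp; ring
          rw [this]
          have := mul_le_mul_of_nonneg_right hJr hγ0
          linarith
      _ ≤ ((π * R * ν) / θ ^ 2) ^ (-(n * γ)) := by
          apply Real.rpow_le_rpow_of_nonpos (by positivity)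
          · have : 2 * (ν / (2 * θ) ^ 2) * (2 * π * R) = (π * R * ν) / θ ^ 2 := by
              field_simp; try ring
            rw [hQ, this]; linarith
          · have : 0 ≤ n * γ := by positivity
            linarith
      _ = _ := by
          rw [Real.rpow_neg (by positivity), ← Real.inv_rpow (by positivity), inv_div]
  have hsub : {ω | (∀ i, 0 < h i ω) ∧ ∑ i, h i ω ≤ n * θ} ⊆
      ⋃ J ∈ (Finset.univ : Finset (Finset ι)).filter (fun J => n ≤ 2 * J.card),
        {ω | ∀ i ∈ J, |h i ω| ≤ 2 * θ} := by
    rintro ω ⟨hpos, hsum⟩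
    simp only [mem_iUnion, Finset.mem_filter, Finset.mem_univ, true_and]
    refine ⟨Finset.univ.filter (fun i => h i ω ≤ 2 * θ), ?_, ?_⟩
    · set G := Finset.univ.filter (fun i => h i ω ≤ 2 * θ)
      set G' := Finset.univ.filter (fun i => ¬ h i ω ≤ 2 * θ)
      have hc : G.card + G'.card = (Finset.univ : Finset ι).card := by
        have hc := Finset.card_filter_add_card_filter_not (s := (Finset.univ : Finset ι)) (fun i => h i ω ≤ 2 * θ)
        convert hc
      have h1 : G'.card * (2 * θ) ≤ n * θ := by
        calc G'.card * (2 * θ) = ∑ i ∈ G', 2 * θ := by simp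
          _ ≤ ∑ i ∈ G', h i ω := Finset.sum_le_sum fun i hi => by
              have := (Finset.mem_filter.1 hi).2
              linarith
          _ ≤ ∑ i, h i ω := Finset.sum_le_sum_of_subset_of_nonneg (Finset.subset_univ _)
              fun i _ _ => (hpos i).le
          _ ≤ _ := hsum
      have h2 : 2 * G'.card ≤ n := by
        have : (2 * G'.card : ℝ) ≤ n := by
          by_contra hcon
          push Not at hcon
          nlinarith
        exact_mod_cast this
      rw [Finset.card_univ] at hc
      omega
    · intro i hi
      rw [abs_of_pos (hpos i)]
      exact (Finset.mem_filter.1 hi).2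
  calc _ ≤ P.real (⋃ J ∈ (Finset.univ : Finset (Finset ι)).filter (fun J => n ≤ 2 * J.card),
        {ω | ∀ i ∈ J, |h i ω| ≤ 2 * θ}) := measureReal_mono hsub (measure_ne_top P _)
    _ ≤ ∑ J ∈ (Finset.univ : Finset (Finset ι)).filter (fun J => n ≤ 2 * J.card),
        P.real {ω | ∀ i ∈ J, |h i ω| ≤ 2 * θ} := measureReal_biUnion_finset_le _ _
    _ ≤ ∑ J ∈ (Finset.univ : Finset (Finset ι)).filter (fun J => n ≤ 2 * J.card), b :=
        Finset.sum_le_sum fun J hJ' => hJ J (Finset.mem_filter.1 hJ').2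
    _ ≤ ∑ J : Finset ι, b := Finset.sum_le_sum_of_subset_of_nonneg (Finset.filter_subset _ _)
        fun _ _ _ => by positivity
    _ = _ := by
        simp [hb, ← hn, mul_pow, mul_assoc]

lemma shifts {Ω : Type*} [MeasurableSpace Ω] {ρ : Measure ℝ} [IsFiniteMeasure ρ]
    {P : Measure Ω} [IsProbabilityMeasure P] {L : ℕ} (hL : 0 < L) {h : ℕ → Ω → ℝ}
    (H : HG ρ P h (fun j => ((j : ℝ) + 1) / L))
    {ν : ℝ} (hν : 0 < ν) {E : Set ℝ} (hE : MeasurableSet E) {R : ℕ} (hR : 0 < R)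
    (hER : E ⊆ Icc (-(π * R)) (π * R))
    (hρ : ∀ A : Set ℝ, MeasurableSet A → ENNReal.ofReal ν * volume (A ∩ E) ≤ ρ A)
    {θ : ℝ} (hθ : 0 < θ) (S w : ℕ) (hw : 0 < w) :
    P.real {ω | (∀ j < S + w * L, 0 < h j ω) ∧ ∑ j : Fin (w * L), h (S + j) ω ≤ w * L * θ} ≤
      2 * ((2 * rexp 1) ^ w *
      ((2 * θ) ^ 2 / (π * R * ν)) ^ (w * (volume.real E / (8 * π * R)))) := by
  classical
  have hmeas := H.meas
  set A := {ω | (∀ j < S + w * L, 0 < h j ω) ∧ ∑ j : Fin (w * L), h (S + j) ω ≤ w * L * θ} with hA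
  let A' : Fin L → Set Ω := fun s => {ω | (∀ i : Fin w, 0 < h (S + (s + L * i)) ω) ∧
    ∑ i : Fin w, h (S + (s + L * i)) ω ≤ w * (2 * θ)}
  set b := (2 * rexp 1) ^ w *
      ((2 * θ) ^ 2 / (π * R * ν)) ^ (w * (volume.real E / (8 * π * R))) with hb
  have hL' : (0 : ℝ) < L := by exact_mod_cast hL
  have hA's : ∀ s, P.real (A' s) ≤ b := by
    intro s
    let g : Fin w ↪ ℕ := ⟨fun i => S + (s + L * i), by
      intro i j hij
      simp only at hij
      have : L * (i : ℕ) = L * j := by omega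
      exact Fin.ext (Nat.eq_of_mul_eq_mul_left hL this)⟩
    have hg : ∀ i, g i = S + (s + L * i) := fun _ => rfl
    have := coarse (H.comp g) (by
      intro i j hij
      refine ⟨(i : ℤ) - j, ?_, ?_⟩
      · intro h0
        apply hij
        apply Fin.ext
        omega
      · simp only [hg]
        push_cast
        field_simp
        ring) hν hE hR hER hρ (θ := 2 * θ) (by positivity)
    simpa [hg, A', hb] using this
  have hmA : MeasurableSet A := by
    have e : A = (⋂ j, ⋂ (_ : j < S + w * L), {ω | 0 < h j ω}) ∩
        {ω | ∑ j : Fin (w * L), h (S + j) ω ≤ w * L * θ} := by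
      ext ω; simp [A]
    rw [e]
    apply MeasurableSet.inter
    · exact MeasurableSet.iInter fun j => MeasurableSet.iInter fun _ =>
        measurableSet_lt measurable_const (hmeas j)
    · exact measurableSet_le (by fun_prop) measurable_const
  have hmA' : ∀ s, MeasurableSet (A' s) := by
    intro s
    have e : A' s = (⋂ i : Fin w, {ω | 0 < h (S + (s + L * i)) ω}) ∩
        {ω | ∑ i : Fin w, h (S + (s + L * i)) ω ≤ w * (2 * θ)} := by
      ext ω; simp [A']
    rw [e]
    apply MeasurableSet.inter
    · exact MeasurableSet.iInter fun j =>
        measurableSet_lt measurable_const (hmeas _)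
    · exact measurableSet_le (by fun_prop) measurable_const
  have hpt : ∀ ω, A.indicator (1 : Ω → ℝ) ω ≤ (2 / L) * ∑ s, (A' s).indicator (1 : Ω → ℝ) ω := by
    intro ω
    by_cases hω : ω ∈ A
    · rw [indicator_of_mem hω]
      obtain ⟨hpos, hsum⟩ := hω
      have hlt : ∀ (s : Fin L) (i : Fin w), S + ((s:ℕ) + L * (i:ℕ)) < S + w * L := by
        intro s i
        have h1 := (finProdFinEquiv (i, s)).2
        simp only [finProdFinEquiv_apply_val] at h1
        omega
      have hre : ∑ j : Fin (w * L), h (S + j) ω = ∑ s : Fin L, ∑ i : Fin w, h (S + (s + L * i)) ω := by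
        rw [← finProdFinEquiv.sum_comp, Fintype.sum_prod_type_right]
        simp
      rw [hre] at hsum
      have hp : ∀ (s : Fin L) (i : Fin w), 0 < h (S + (s + L * i)) ω := fun s i => hpos _ (hlt s i)
      have hle : ∀ s : Fin L, 1 - (A' s).indicator (1 : Ω → ℝ) ω ≤
          (∑ i : Fin w, h (S + (s + L * i)) ω) / (w * (2 * θ)) := by
        intro s
        have hs0 : 0 ≤ ∑ i : Fin w, h (S + (s + L * i)) ω := Finset.sum_nonneg fun i _ => (hp s i).le
        by_cases hs : ω ∈ A' s
        · rw [indicator_of_mem hs]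
          simp only [Pi.one_apply, sub_self]
          positivity
        · rw [indicator_of_notMem hs, sub_zero, one_le_div (by positivity)]
          by_contra hcon
          push Not at hcon
          exact hs ⟨hp s, hcon.le⟩
      have hs2 := Finset.sum_le_sum (s := Finset.univ) fun s _ => hle s
      rw [← Finset.sum_div, Finset.sum_sub_distrib] at hs2
      simp only [Finset.sum_const, Finset.card_univ, Fintype.card_fin, nsmul_eq_mul, mul_one] at hs2
      have h3 : (∑ s : Fin L, ∑ i : Fin w, h (S + (s + L * i)) ω) / (w * (2 * θ)) ≤ L / 2 := by
        rw [div_le_iff₀ (by positivity)]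
        linarith
      simp only [Pi.one_apply]
      rw [div_mul_eq_mul_div, le_div_iff₀ hL']
      linarith
    · rw [indicator_of_notMem hω]
      exact mul_nonneg (by positivity) (Finset.sum_nonneg fun s _ => indicator_nonneg (fun _ _ => by simp) _)
  have hi : ∀ s ∈ Finset.univ, Integrable ((A' s).indicator (1 : Ω → ℝ)) P := fun s _ =>
    (integrable_const (1:ℝ)).indicator (hmA' s)
  calc P.real A = ∫ ω, A.indicator (1 : Ω → ℝ) ω ∂P := (integral_indicator_one hmA).symm
    _ ≤ ∫ ω, (2 / L) * ∑ s, (A' s).indicator (1 : Ω → ℝ) ω ∂P :=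
        integral_mono ((integrable_const (1:ℝ)).indicator hmA)
          ((integrable_finsetSum _ hi).const_mul _) hpt
    _ = (2 / L) * ∑ s, P.real (A' s) := by
        rw [integral_const_mul, integral_finsetSum _ hi]
        simp_rw [integral_indicator_one (hmA' _)]
    _ ≤ (2 / L) * ∑ s : Fin L, b := by
        gcongr with s _
        exact hA's s
    _ = _ := by
        simp
        field_simp

def gpoly (m b K : ℕ) : Polynomial ℝ :=
  (∑ i ∈ Finset.range m, Polynomial.X ^ i) * (∑ i ∈ Finset.range b, Polynomial.X ^ i) ^ K

lemma gpoly_zero_coeff (m b n : ℕ) : (gpoly m b 0).coeff n = if n < m then 1 else 0 := by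
  simp [gpoly, Polynomial.coeff_X_pow]

lemma gpoly_succ_coeff (m b K n : ℕ) : (gpoly m b (K + 1)).coeff n =
    ∑ i ∈ Finset.range b, if i ≤ n then (gpoly m b K).coeff (n - i) else 0 := by
  have : gpoly m b (K + 1) = ∑ i ∈ Finset.range b, gpoly m b K * Polynomial.X ^ i := by
    rw [← Finset.mul_sum]; unfold gpoly; rw [pow_succ]; ring
  rw [this, Polynomial.finsetSum_coeff]
  simp_rw [Polynomial.coeff_mul_X_pow']

lemma gpoly_nonneg (m b K n : ℕ) : 0 ≤ (gpoly m b K).coeff n := by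
  induction K generalizing n with
  | zero => rw [gpoly_zero_coeff]; split_ifs <;> simp
  | succ K ih =>
    rw [gpoly_succ_coeff]
    refine Finset.sum_nonneg fun i _ => ?_
    split_ifs
    · exact ih _
    · rfl

lemma gpoly_ge (m b K n : ℕ) (h1 : K * b ≤ n) (h2 : n < m) : (b : ℝ) ^ K ≤ (gpoly m b K).coeff n := by
  induction K generalizing n with
  | zero => rw [gpoly_zero_coeff]; simp [h2]
  | succ K ih =>
    rw [gpoly_succ_coeff]
    calc (b : ℝ) ^ (K + 1) = ∑ i ∈ Finset.range b, (b : ℝ) ^ K := by simp; ring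
      _ ≤ _ := Finset.sum_le_sum fun i hi => by
        have hi := Finset.mem_range.1 hi
        rw [Nat.succ_mul] at h1
        rw [if_pos (by omega)]
        exact ih _ (by omega) (by omega)

lemma gpoly_deg (m b K n : ℕ) (h1 : m + K * b ≤ n) : (gpoly m b K).coeff n = 0 := by
  induction K generalizing n with
  | zero => rw [gpoly_zero_coeff]; simp; omega
  | succ K ih =>
    rw [gpoly_succ_coeff]
    refine Finset.sum_eq_zero fun i hi => ?_
    have hi := Finset.mem_range.1 hi
    rw [Nat.succ_mul] at h1
    split_ifs
    · exact ih _ (by omega)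
    · rfl

lemma gpoly_eval (m b K : ℕ) (z : ℂ) :
    ∑ j ∈ Finset.range (m + K * b), ((gpoly m b K).coeff j : ℂ) * z ^ j =
      (∑ i ∈ Finset.range m, z ^ i) * (∑ i ∈ Finset.range b, z ^ i) ^ K := by
  have h1 : Polynomial.aeval z (gpoly m b K) =
      (∑ i ∈ Finset.range m, z ^ i) * (∑ i ∈ Finset.range b, z ^ i) ^ K := by
    simp [gpoly]
  by_cases h0 : m + K * b = 0
  · have hm : m = 0 := by omega
    rw [h0, hm]; simp
  rw [← h1, Polynomial.aeval_eq_sum_range' (n := m + K * b)]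
  · simp [Algebra.smul_def]
  · have : (gpoly m b K).natDegree ≤ m + K * b - 1 :=
      Polynomial.natDegree_le_iff_coeff_eq_zero.2 fun n hn => gpoly_deg m b K n (by omega)
    omega

lemma geo_le (b : ℕ) (z : ℂ) (hz : ‖z‖ = 1) : ‖∑ i ∈ Finset.range b, z ^ i‖ ≤ b := by
  refine (norm_sum_le _ _).trans ?_
  simp [hz]

lemma geo_le' (b : ℕ) (θ : ℝ) (h0 : θ ≠ 0) (h1 : |θ| ≤ π) :
    ‖∑ i ∈ Finset.range b, (Complex.exp (Complex.I * θ)) ^ i‖ ≤ π / |θ| := by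
  set z := Complex.exp (Complex.I * θ) with hz
  have hz1 : ‖z‖ = 1 := by rw [hz, mul_comm]; exact Complex.norm_exp_ofReal_mul_I θ
  have h2 : 2 / π * |θ| ≤ ‖z - 1‖ := by
    rw [hz, Complex.norm_exp_I_mul_ofReal_sub_one, norm_mul, Real.norm_eq_abs, Real.norm_eq_abs]
    have := Real.mul_abs_le_abs_sin (x := θ / 2) (by rw [abs_div, abs_two]; linarith)
    rw [abs_div] at this
    rw [abs_two] at this ⊢
    linarith
  have h3 : ‖(∑ i ∈ Finset.range b, z ^ i)‖ * ‖z - 1‖ ≤ 2 := by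
    rw [← norm_mul, geom_sum_mul]
    refine (norm_sub_le _ _).trans ?_
    simp [hz1]; norm_num
  have hθ : 0 < |θ| := abs_pos.2 h0
  rw [le_div_iff₀ hθ]
  have h4 := mul_le_mul_of_nonneg_left h2 (norm_nonneg (∑ i ∈ Finset.range b, z ^ i))
  have h5 : ‖∑ i ∈ Finset.range b, z ^ i‖ * (2 / π * |θ|) ≤ 2 := h4.trans h3
  have h6 : ‖∑ i ∈ Finset.range b, z ^ i‖ * (2 / π * |θ|) = 2 * (‖∑ i ∈ Finset.range b, z ^ i‖ * |θ|) / π := by ring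
  rw [h6, div_le_iff₀ pi_pos] at h5
  linarith

lemma qf_complex (L : ℕ) (s : Finset ℕ) (a : ℕ → ℝ) (l : ℝ) :
    qf (fun j : ℕ => ((j : ℝ) + 1) / L) s a l =
      ‖∑ j ∈ s, (a j : ℂ) * (Complex.exp (Complex.I * (l / L : ℝ))) ^ j‖ ^ 2 := by
  set z := Complex.exp (Complex.I * (l / L : ℝ)) with hz
  have hz1 : ‖z‖ = 1 := by rw [hz, mul_comm]; exact Complex.norm_exp_ofReal_mul_I _
  have h1 : ‖∑ j ∈ s, (a j : ℂ) * z ^ j‖ = ‖∑ j ∈ s, (a j : ℂ) * z ^ (j + 1)‖ := by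
    simp_rw [pow_succ, ← mul_assoc]
    rw [← Finset.sum_mul, norm_mul, hz1, mul_one]
  have h2 : ∀ j : ℕ, z ^ (j + 1) = ((cos (l * (((j : ℝ) + 1) / L)) : ℝ) : ℂ) + ((sin (l * (((j : ℝ) + 1) / L)) : ℝ) : ℂ) * Complex.I := by
    intro j
    rw [hz, ← Complex.exp_nat_mul, Complex.ofReal_cos, Complex.ofReal_sin, ← Complex.exp_mul_I]
    congr 1
    push_cast
    ring
  have h3 : ∑ j ∈ s, (a j : ℂ) * z ^ (j + 1) =
      ((∑ j ∈ s, a j * cos (l * (((j : ℝ) + 1) / L)) : ℝ) : ℂ) +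
      ((∑ j ∈ s, a j * sin (l * (((j : ℝ) + 1) / L)) : ℝ) : ℂ) * Complex.I := by
    simp_rw [h2]
    push_cast
    rw [Finset.sum_mul, ← Finset.sum_add_distrib]
    exact Finset.sum_congr rfl fun j _ => by ring
  rw [h1, h3, Complex.sq_norm, Complex.normSq_add_mul_I]
  rfl

def wt (m b K : ℕ) (j : ℕ) : ℝ := (gpoly m b K).coeff j / (m * b ^ K)

lemma qf_wt (m b K L : ℕ) (hm : 0 < m) (hb : 0 < b) (l : ℝ) :
    qf (fun j : ℕ => ((j : ℝ) + 1) / L) (Finset.range (m + K * b)) (wt m b K) l ≤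
      (‖∑ i ∈ Finset.range b, (Complex.exp (Complex.I * (l / L : ℝ))) ^ i‖ / b) ^ (2 * K) := by
  rw [qf_complex]
  set z := Complex.exp (Complex.I * (l / L : ℝ)) with hz
  have hz1 : ‖z‖ = 1 := by rw [hz, mul_comm]; exact Complex.norm_exp_ofReal_mul_I _
  have hm' : (0:ℝ) < m := by exact_mod_cast hm
  have hb' : (0:ℝ) < b := by exact_mod_cast hb
  have e : ∑ j ∈ Finset.range (m + K * b), (wt m b K j : ℂ) * z ^ j =
      ((∑ i ∈ Finset.range m, z ^ i) * (∑ i ∈ Finset.range b, z ^ i) ^ K) / ((m * b ^ K : ℝ) : ℂ) := by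
    rw [← gpoly_eval, Finset.sum_div]
    refine Finset.sum_congr rfl fun j _ => ?_
    unfold wt
    push_cast
    ring
  rw [e, norm_div, norm_mul, norm_pow, Complex.norm_real, Real.norm_of_nonneg (by positivity), mul_comm 2 K, pow_mul]
  gcongr
  rw [div_pow, mul_div_mul_comm]
  exact mul_le_of_le_one_left (by positivity) (div_le_one_of_le₀ (geo_le _ _ hz1) hm'.le)

lemma var_bound (ρ : Measure ℝ) [IsFiniteMeasure ρ] (m β K L : ℕ) (hm : 0 < m) (hβ : 0 < β) (hL : 0 < L)
    (hK : 0 < K) (M : ℝ≥0∞) (hM : M = ∫⁻ l, (ENNReal.ofReal |l|) ^ (-(2 * K : ℝ)) ∂ρ) (hM' : M < ⊤) :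
    ∫ l, qf (fun j : ℕ => ((j : ℝ) + 1) / L) (Finset.range (m + K * (β * L))) (wt m (β * L) K) l ∂ρ ≤
      (π / β) ^ (2 * K) * M.toReal + ρ.real {l | π * L < |l|} := by
  have hβ' : (0:ℝ) < β := by exact_mod_cast hβ
  have hL' : (0:ℝ) < L := by exact_mod_cast hL
  have hms : MeasurableSet {l : ℝ | π * L < |l|} := measurableSet_lt measurable_const measurable_id.abs
  have hpt : ∀ l : ℝ, ENNReal.ofReal (qf (fun j : ℕ => ((j : ℝ) + 1) / L) (Finset.range (m + K * (β * L))) (wt m (β * L) K) l) ≤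
      ENNReal.ofReal ((π / β) ^ (2 * K)) * (ENNReal.ofReal |l|) ^ (-(2 * K : ℝ)) +
      ({l : ℝ | π * L < |l|}).indicator 1 l := by
    intro l
    have hq := qf_wt m (β * L) K L hm (by positivity) l
    by_cases hl : π * L < |l|
    · rw [indicator_of_mem (by exact hl)]
      refine le_add_left ?_
      simp only [Pi.one_apply]
      rw [ENNReal.ofReal_le_one]
      refine hq.trans ?_
      apply pow_le_one₀ (by positivity)
      apply div_le_one_of_le₀ _ (by positivity)
      apply geo_le
      rw [mul_comm]; exact Complex.norm_exp_ofReal_mul_I _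
    · refine le_add_right ?_
      by_cases h0 : l = 0
      · subst h0
        have : ENNReal.ofReal |(0:ℝ)| ^ (-(2 * K : ℝ)) = ⊤ := by
          simp [hK]
        rw [this, ENNReal.mul_top]
        · exact le_top
        · rw [Ne, ENNReal.ofReal_eq_zero, not_le]; positivity
      · have hl0 : 0 < |l| := abs_pos.2 h0
        push Not at hl
        have e : ENNReal.ofReal |l| ^ (-(2 * K : ℝ)) = ENNReal.ofReal ((|l| ^ (2 * K))⁻¹) := by
          rw [ENNReal.ofReal_rpow_of_pos hl0, Real.rpow_neg hl0.le]
          congr 2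
          rw [← Real.rpow_natCast]; push_cast; rfl
        rw [e, ← ENNReal.ofReal_mul (by positivity)]
        apply ENNReal.ofReal_le_ofReal
        refine hq.trans ?_
        rw [← inv_pow, ← mul_pow]
        gcongr
        have := geo_le' (β * L) (l / L) (by positivity) (by rw [abs_div, abs_of_pos hL', div_le_iff₀ hL']; exact hl)
        rw [div_le_iff₀ (by positivity)]
        refine this.trans (le_of_eq ?_)
        rw [abs_div, abs_of_pos hL']
        push_cast
        field_simp
  rw [integral_eq_lintegral_of_nonneg_ae (Filter.Eventually.of_forall fun l => qf_nonneg _ _ _ _)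
    (qf_cont _ _ _).aestronglyMeasurable]
  have h2 : ∫⁻ l, ENNReal.ofReal (qf (fun j : ℕ => ((j : ℝ) + 1) / L) (Finset.range (m + K * (β * L))) (wt m (β * L) K) l) ∂ρ ≤
      ENNReal.ofReal ((π / β) ^ (2 * K)) * M + ρ {l | π * L < |l|} := by
    refine (lintegral_mono hpt).trans (le_of_eq ?_)
    rw [lintegral_add_right _ (measurable_one.indicator hms), lintegral_const_mul _ (by fun_prop),
      lintegral_indicator_one hms, hM]
  have h3 := ENNReal.toReal_mono (by finiteness) h2
  refine h3.trans (le_of_eq ?_)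
  rw [ENNReal.toReal_add (by finiteness) (by finiteness), ENNReal.toReal_mul, ENNReal.toReal_ofReal (by positivity)]
  rfl

lemma gauss_tail {Ω : Type*} [MeasurableSpace Ω] {P : Measure Ω} [IsProbabilityMeasure P]
    {X : Ω → ℝ} {v : ℝ≥0} (hX : P.map X = gaussianReal 0 v) {T V : ℝ} (hT : 0 < T) (hV : 0 < V)
    (hvV : v ≤ V) : P.real {ω | T ≤ X ω} ≤ rexp (-(T ^ 2 / (2 * V))) := by
  have hX_meas : AEMeasurable X P := aemeasurable_of_map_neZero (by rw [hX]; infer_instance)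
  have hint : Integrable (fun ω => rexp ((T / V) * X ω)) P := by
    have := integrable_exp_mul_gaussianReal (μ := 0) (v := v) (T / V)
    rw [← hX] at this
    exact this.comp_aemeasurable hX_meas
  refine (measure_ge_le_exp_mul_mgf T (by positivity : 0 ≤ T / V) hint).trans ?_
  rw [mgf_gaussianReal hX, ← Real.exp_add]
  apply Real.exp_le_exp.2
  have : (v : ℝ) * (T / V) ^ 2 / 2 ≤ V * (T / V) ^ 2 / 2 := by gcongr
  have e : V * (T / V) ^ 2 / 2 = T ^ 2 / (2 * V) := by field_simp
  have e2 : T / V * T = 2 * (T ^ 2 / (2 * V)) := by field_simp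
  have e3 : -(T / V) * T = - (T / V * T) := by ring
  rw [e3, e2]
  linarith

lemma main_bound {Ω : Type*} [MeasurableSpace Ω] {ρ : Measure ℝ} [IsFiniteMeasure ρ]
    {P : Measure Ω} [IsProbabilityMeasure P] {L : ℕ} (hL : 0 < L) {h : ℕ → Ω → ℝ}
    (H : HG ρ P h (fun j => ((j : ℝ) + 1) / L))
    {ν : ℝ} (hν : 0 < ν) {E : Set ℝ} (hE : MeasurableSet E) {R : ℕ} (hR : 0 < R)
    (hER : E ⊆ Icc (-(π * R)) (π * R))
    (hρ : ∀ A : Set ℝ, MeasurableSet A → ENNReal.ofReal ν * volume (A ∩ E) ≤ ρ A)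
    {K β : ℕ} (hK : 0 < K) (hβ : 0 < β)
    (M : ℝ≥0∞) (hM : M = ∫⁻ l, (ENNReal.ofReal |l|) ^ (-(2 * K : ℝ)) ∂ρ) (hM' : M < ⊤)
    {T V : ℝ} (hT : 0 < T) (hV : 0 < V)
    (hVb : (π / β) ^ (2 * K) * M.toReal + ρ.real {l | π * L < |l|} ≤ V) :
    P.real {ω | ∀ j < 3 * (K * β * L), 0 < h j ω} ≤ rexp (-(T ^ 2 / (2 * V))) +
      2 * ((2 * rexp 1) ^ (K * β) *
      ((4 * T) ^ 2 / (π * R * ν)) ^ ((K * β : ℕ) * (volume.real E / (8 * π * R)))) := by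
  set w := K * β with hw
  have hw0 : 0 < w := by positivity
  set W := w * L with hW
  have hW0 : 0 < W := by positivity
  have hW0' : (0:ℝ) < W := by exact_mod_cast hW0
  have hb0 : (0:ℝ) < (β * L : ℕ) := by exact_mod_cast Nat.mul_pos hβ hL
  have hlen : 2 * W + K * (β * L) = 3 * W := by rw [hW, hw]; ring
  have hvar := var_bound ρ (2 * W) β K L (by positivity) hβ hL hK M hM hM'
  have hlaw := H.law (Finset.range (2 * W + K * (β * L))) (wt (2 * W) (β * L) K)
  set X := fun ω => ∑ j ∈ Finset.range (2 * W + K * (β * L)), wt (2 * W) (β * L) K j * h j ω with hX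
  have ht := gauss_tail hlaw hT hV (by
    rw [Real.coe_toNNReal']
    exact max_le (hvar.trans hVb) hV.le)
  have hs := shifts hL H hν hE hR hER hρ (θ := 2 * T) (by positivity) W w hw0
  have e4 : 2 * (2 * T) = 4 * T := by ring
  rw [e4] at hs
  have hsub : {ω | ∀ j < 3 * W, 0 < h j ω} ⊆ {ω | T ≤ X ω} ∪
      {ω | (∀ j < W + w * L, 0 < h j ω) ∧ ∑ j : Fin (w * L), h (W + j) ω ≤ w * L * (2 * T)} := by
    intro ω hω
    simp only [Set.mem_setOf_eq] at hω
    by_cases hTX : T ≤ X ω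
    · exact Or.inl hTX
    · right
      push Not at hTX
      refine ⟨fun j hj => hω j (by omega), ?_⟩
      have e : ∑ j : Fin (w * L), h (W + j) ω = ∑ j ∈ Finset.Ico W (2 * W), h j ω := by
        rw [Fin.sum_univ_eq_sum_range (fun j => h (W + j) ω), Finset.sum_Ico_eq_sum_range]
        congr 2
        omega
      have hle : ∑ j ∈ Finset.Ico W (2 * W), h j ω / (2 * W) ≤ X ω := by
        calc ∑ j ∈ Finset.Ico W (2 * W), h j ω / (2 * W)
            ≤ ∑ j ∈ Finset.Ico W (2 * W), wt (2 * W) (β * L) K j * h j ω := by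
              refine Finset.sum_le_sum fun j hj => ?_
              have hj := Finset.mem_Ico.1 hj
              have hp := hω j (by omega)
              rw [div_eq_inv_mul]
              gcongr
              unfold wt
              have := gpoly_ge (2 * W) (β * L) K j (by omega) hj.2
              rw [le_div_iff₀ (by push_cast at hb0 ⊢; positivity)]
              push_cast at this ⊢
              rw [← mul_assoc, inv_mul_cancel₀ (by positivity), one_mul]
              exact this
          _ ≤ _ := by
              refine Finset.sum_le_sum_of_subset_of_nonneg ?_ ?_
              · intro j hj
                have hj := Finset.mem_Ico.1 hj
                exact Finset.mem_range.2 (by omega)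
              · intro j hj _
                have := hω j (by have := Finset.mem_range.1 hj; omega)
                have h2 := gpoly_nonneg (2 * W) (β * L) K j
                unfold wt
                positivity
      rw [← Finset.sum_div, ← e] at hle
      have h5 := hle.trans hTX.le
      rw [div_le_iff₀ (by positivity)] at h5
      have : (W:ℝ) = w * L := by rw [hW]; push_cast; rfl
      rw [← this]
      linarith
  calc _ ≤ P.real ({ω | T ≤ X ω} ∪
      {ω | (∀ j < W + w * L, 0 < h j ω) ∧ ∑ j : Fin (w * L), h (W + j) ω ≤ w * L * (2 * T)}) :=
        measureReal_mono hsub (measure_ne_top P _)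
    _ ≤ _ := measureReal_union_le _ _
    _ ≤ _ := add_le_add ht hs

lemma numerics {γ D : ℝ} (hγ : 0 < γ) (hD : 0 < D) : ∃ y0 C : ℝ, 1 < y0 ∧ 0 < C ∧
    ∀ y : ℝ, y0 ≤ y → ∀ K β : ℕ, 0 < K → y ^ 8 / 8 ≤ β →
    rexp (-(((y ^ K)⁻¹) ^ 2 / (2 * (2 * (8 * π) ^ (2 * K) / y ^ (7 * K + 8))))) +
      2 * ((2 * rexp 1) ^ (K * β) *
      ((4 * (y ^ K)⁻¹) ^ 2 / D) ^ ((K * β : ℕ) * γ)) ≤ rexp (-(C * (K * y ^ 8) * K * log y)) := by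
  set B := (1 + 2 * log 2 + γ * |log (16 / D)|) / γ with hB
  set c1 := min 8 (γ / 8) with hc1
  have hc1p : 0 < c1 := by positivity
  have hlog2 : 0 < log 2 := Real.log_pos (by norm_num)
  set y0 := max 64 (max (rexp B) (rexp (2 * log 2 / c1))) with hy0
  refine ⟨y0, c1 / 2, ?_, by positivity, ?_⟩
  · exact lt_of_lt_of_le (by norm_num) (le_max_left _ _)
  intro y hy K β hK hβ
  have hy64 : 64 ≤ y := (le_max_left _ _).trans hy
  have hyB : B ≤ log y := by
    rw [Real.le_log_iff_exp_le (by linarith)]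
    exact ((le_max_left _ _).trans (le_max_right _ _)).trans hy
  have hyc : 2 * log 2 / c1 ≤ log y := by
    rw [Real.le_log_iff_exp_le (by linarith)]
    exact ((le_max_right _ _).trans (le_max_right _ _)).trans hy
  have hyp : 0 < y := by linarith
  have hK1 : (1:ℝ) ≤ K := by exact_mod_cast hK
  have hlogy : 0 < log y := Real.log_pos (by linarith)
  have hy8 : 1 ≤ y ^ 8 := one_le_pow₀ (by linarith)
  have hyK : (32 : ℝ) * K ≤ y ^ K := by
    have h1 : (64:ℝ) ^ K ≤ y ^ K := by gcongr
    have h2 : 1 + (K:ℝ) * 63 ≤ (1 + 63) ^ K := one_add_mul_le_pow (by norm_num) K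
    norm_num at h2
    linarith
  -- first term
  have first : 8 * (K * y ^ 8) * K * log y ≤ ((y ^ K)⁻¹) ^ 2 / (2 * (2 * (8 * π) ^ (2 * K) / y ^ (7 * K + 8))) := by
    have e : ((y ^ K)⁻¹) ^ 2 / (2 * (2 * (8 * π) ^ (2 * K) / y ^ (7 * K + 8))) =
        y ^ (5 * K + 8) / (4 * (8 * π) ^ (2 * K)) := by
      have : y ^ (7 * K + 8) = y ^ (5 * K + 8) * (y ^ K) ^ 2 := by
        rw [← pow_mul, ← pow_add]; congr 1; ring
      rw [this]
      field_simp
      norm_num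
    rw [e, le_div_iff₀ (by positivity)]
    have h1 : (8 * π) ^ (2 * K) ≤ y ^ (2 * K) := by
      gcongr; have := Real.pi_lt_four; linarith
    have h2 : log y ≤ y ^ K := by
      have h3 := Real.log_le_sub_one_of_pos hyp
      have h4 : y ^ 1 ≤ y ^ K := pow_le_pow_right₀ (by linarith) hK
      rw [pow_one] at h4
      linarith
    calc 8 * (K * y ^ 8) * K * log y * (4 * (8 * π) ^ (2 * K))
        ≤ 8 * (K * y ^ 8) * K * y ^ K * (4 * y ^ (2 * K)) := by gcongr
      _ = (32 * (K:ℝ)) * K * (y ^ K * y ^ (2 * K) * y ^ 8) := by ring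
      _ ≤ y ^ K * y ^ K * (y ^ K * y ^ (2 * K) * y ^ 8) := by
          gcongr
          linarith
      _ = _ := by ring
  have firstE : rexp (-(((y ^ K)⁻¹) ^ 2 / (2 * (2 * (8 * π) ^ (2 * K) / y ^ (7 * K + 8))))) ≤
      rexp (-(c1 * (K * y ^ 8) * K * log y)) := by
    apply Real.exp_le_exp.2
    have : c1 * (K * y ^ 8) * K * log y ≤ 8 * (K * y ^ 8) * K * log y := by
      gcongr; exact min_le_left _ _
    linarith
  have secondE : 2 * ((2 * rexp 1) ^ (K * β) *
      ((4 * (y ^ K)⁻¹) ^ 2 / D) ^ ((K * β : ℕ) * γ)) ≤ rexp (-(c1 * (K * y ^ 8) * K * log y)) := by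
    set w := K * β with hw
    have hwr : (w : ℝ) = K * β := by rw [hw]; push_cast; rfl
    have hβ1 : (1 : ℝ) ≤ β := by
      have hy8 : (64:ℝ) ^ 8 ≤ y ^ 8 := by gcongr
      norm_num at hy8
      linarith
    have hw1 : (1 : ℝ) ≤ w := by rw [hwr]; nlinarith
    have hwN : K * y ^ 8 / 8 ≤ w := by
      rw [hwr, mul_div_assoc]; gcongr
    have e1 : (2:ℝ) = rexp (log 2) := (Real.exp_log (by norm_num)).symm
    have e2 : (2 * rexp 1) ^ w = rexp (w * (log 2 + 1)) := by
      rw [Real.exp_nat_mul, Real.exp_add, ← e1]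
    have e3 : ((4 * (y ^ K)⁻¹) ^ 2 / D) = rexp (log (16 / D) - 2 * K * log y) := by
      rw [Real.exp_sub, Real.exp_log (by positivity)]
      have : rexp (2 * K * log y) = (y ^ K) ^ 2 := by
        rw [← pow_mul, ← Real.rpow_natCast, Real.rpow_def_of_pos hyp]
        push_cast; congr 1; ring
      rw [this]
      field_simp
      norm_num
    rw [e2, e3, ← Real.exp_mul]
    calc 2 * (rexp (w * (log 2 + 1)) * rexp ((log (16 / D) - 2 * K * log y) * (w * γ)))
        = rexp (log 2 + (w * (log 2 + 1) + (log (16 / D) - 2 * K * log y) * (w * γ))) := by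
          rw [Real.exp_add, Real.exp_add, ← e1]
      _ ≤ _ := by
          apply Real.exp_le_exp.2
          have hBγ : 1 + 2 * log 2 + γ * |log (16 / D)| ≤ γ * log y := by
            rw [hB, div_le_iff₀ hγ] at hyB; linarith
          have h1 : log 2 ≤ w * log 2 := by nlinarith
          have h2 : log (16 / D) * (w * γ) ≤ |log (16 / D)| * (w * γ) := by
            gcongr; exact le_abs_self _
          have h3 : w * (1 + 2 * log 2 + γ * |log (16 / D)|) ≤ w * (γ * log y) := by gcongr
          have h4 : w * (γ * log y) ≤ w * (γ * log y) * K := by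
            apply le_mul_of_one_le_right _ hK1; positivity
          have h5 : c1 * (K * y ^ 8) * K * log y ≤ (γ / 8) * (K * y ^ 8) * K * log y := by
            gcongr; exact min_le_right _ _
          have h6 : (K * y ^ 8 / 8) * (γ * K * log y) ≤ w * (γ * K * log y) := by gcongr
          nlinarith
  calc _ ≤ rexp (-(c1 * (K * y ^ 8) * K * log y)) + rexp (-(c1 * (K * y ^ 8) * K * log y)) :=
        add_le_add firstE secondE
    _ = rexp (log 2 + -(c1 * (K * y ^ 8) * K * log y)) := by
        rw [Real.exp_add, Real.exp_log (by norm_num)]; ring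
    _ ≤ _ := by
        apply Real.exp_le_exp.2
        rw [div_le_iff₀ hc1p] at hyc
        have h1 : 1 ≤ (K:ℝ) * y ^ 8 * K := by
          have := mul_le_mul hK1 hy8 (by norm_num) (by positivity)
          nlinarith
        have h2 : log y * c1 ≤ log y * c1 * (K * y ^ 8 * K) := le_mul_of_one_le_right (by positivity) h1
        nlinarith

lemma core {Ω : Type*} [MeasurableSpace Ω] {ρ : Measure ℝ} [IsFiniteMeasure ρ]
    {P : Measure Ω} [IsProbabilityMeasure P]
    {ν : ℝ} (hν : 0 < ν) {E : Set ℝ} (hE : MeasurableSet E) (hEb : Bornology.IsBounded E)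
    (hEv : 0 < volume E)
    (hρ : ∀ A : Set ℝ, MeasurableSet A → ENNReal.ofReal ν * volume (A ∩ E) ≤ ρ A)
    (A : ℝ → Set Ω) (hpos : ∀ N, 0 < P.real (A N))
    (hA : ∀ κ : ℝ, 0 < κ → ∃ L : ℕ, 0 < L ∧ ∃ h : ℕ → Ω → ℝ,
      HG ρ P h (fun j => ((j : ℝ) + 1) / L) ∧ ρ.real {l | π * L < |l|} ≤ κ ∧
      ∀ (N : ℝ) (n : ℕ), (n : ℝ) ≤ N → A N ⊆ {ω | ∀ j < n * L, 0 < h j ω})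
    (M : ℕ → ℝ≥0∞) (hM : ∀ K : ℕ, M K = ∫⁻ l, (ENNReal.ofReal |l|) ^ (-(2 * K : ℝ)) ∂ρ) :
    ∃ C c N₀ : ℝ, 0 < C ∧ 0 < c ∧ 0 < N₀ ∧
      ∀ N : ℝ, N₀ < N → ∀ K : ℕ, 0 < K → (K : ℝ) ≤ N → M K < ⊤ →
        (K : ℝ) * ((M K).toReal) ^ (1 / (K : ℝ)) ≤ N →
        Real.log (P.real (A N)) ≤ -C * N * K * Real.log (c * N / K) := by
  obtain ⟨R, hR, hER⟩ : ∃ R : ℕ, 0 < R ∧ E ⊆ Icc (-(π * R)) (π * R) := by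
    obtain ⟨r, hr⟩ := hEb.subset_closedBall 0
    obtain ⟨R, hR⟩ := exists_nat_gt (max r 0)
    have hR0 : (0:ℝ) < R := (le_max_right _ _).trans_lt hR
    refine ⟨R, by exact_mod_cast hR0, hr.trans ?_⟩
    rw [Real.closedBall_eq_Icc]
    have h1 : r ≤ π * R := by
      have := (le_max_left r 0).trans hR.le
      have := Real.pi_gt_three
      nlinarith
    apply Icc_subset_Icc <;> linarith
  have hEf : volume E ≠ ⊤ := ne_top_of_le_ne_top (by simp) (measure_mono hER)
  have hEr : 0 < volume.real E := ENNReal.toReal_pos hEv.ne' hEf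
  have hR' : (0:ℝ) < R := by exact_mod_cast hR
  obtain ⟨y0, C, hy0, hC, hnum⟩ := numerics (γ := volume.real E / (8 * π * R)) (D := π * R * ν)
    (by positivity) (by positivity)
  set S := ∑ k ∈ Finset.range 8, (M k).toReal + 1 with hS
  have hS0 : 0 < S := by positivity
  set y1 := max y0 2 with hy1
  have hy10 : y0 ≤ y1 := le_max_left _ _
  have hy12 : 2 ≤ y1 := le_max_right _ _
  refine ⟨C / 8, 1 / y1 ^ 8, 8 * S ^ 8, by positivity, by positivity, by positivity, ?_⟩
  intro N hN K hK hKN hMK hMN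
  have hK' : (0:ℝ) < K := by exact_mod_cast hK
  have hK1 : (1:ℝ) ≤ K := by exact_mod_cast hK
  have hN0 : 0 < N := by linarith
  have hPle : P.real (A N) ≤ 1 := measureReal_le_one
  by_cases hx : N / K < y1 ^ 8
  · have h1 : 1 / y1 ^ 8 * N / K ≤ 1 := by
      rw [mul_div_assoc, one_div, inv_mul_le_iff₀ (by positivity), mul_one]; exact hx.le
    have h2 : Real.log (1 / y1 ^ 8 * N / K) ≤ 0 := Real.log_nonpos (by positivity) h1
    have h3 : Real.log (P.real (A N)) ≤ 0 := Real.log_nonpos (hpos N).le hPle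
    have h4 : 0 ≤ (C / 8 * N * K) * -Real.log (1 / y1 ^ 8 * N / K) := by
      apply mul_nonneg (by positivity); linarith
    linarith
  push Not at hx
  set y := (N / K) ^ (1 / 8 : ℝ) with hy
  have hxpos : 0 < N / K := by positivity
  have hy8 : y ^ 8 = N / K := by
    rw [hy, ← Real.rpow_natCast, ← Real.rpow_mul hxpos.le]; norm_num
  have hyp : 0 < y := Real.rpow_pos_of_pos hxpos _
  have hyy1 : y1 ≤ y := by
    rw [← hy8] at hx
    exact le_of_pow_le_pow_left₀ (by norm_num) hyp.le hx
  have hy2 : 2 ≤ y := hy12.trans hyy1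
  have hMy : (M K).toReal * y ^ 8 ≤ y ^ (9 * K) := by
    by_cases hK8 : K < 8
    · have h1 : (M K).toReal ≤ S := by
        have := Finset.single_le_sum (f := fun k => (M k).toReal) (s := Finset.range 8)
          (fun _ _ => ENNReal.toReal_nonneg) (Finset.mem_range.2 hK8)
        linarith
      have h2 : S ≤ y := by
        refine le_of_pow_le_pow_left₀ (n := 8) (by norm_num) hyp.le ?_
        rw [hy8, le_div_iff₀ hK']
        have : (K:ℝ) ≤ 8 := by exact_mod_cast hK8.le
        nlinarith [pow_pos hS0 8]
      calc (M K).toReal * y ^ 8 ≤ y * y ^ 8 := by gcongr; exact h1.trans h2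
        _ = y ^ 9 := by ring
        _ ≤ _ := pow_le_pow_right₀ (by linarith) (by omega)
    · have h1 : (M K).toReal ^ (1 / (K:ℝ)) ≤ N / K := by
        rw [le_div_iff₀ hK']; linarith
      have h2 : (M K).toReal ≤ (N / K) ^ K := by
        have := pow_le_pow_left₀ (by positivity) h1 K
        rwa [← Real.rpow_natCast, ← Real.rpow_mul ENNReal.toReal_nonneg, one_div_mul_cancel hK'.ne', Real.rpow_one] at this
      rw [← hy8, ← pow_mul] at h2
      calc (M K).toReal * y ^ 8 ≤ y ^ (8 * K) * y ^ 8 := by gcongr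
        _ = y ^ (8 * K + 8) := by ring
        _ ≤ _ := pow_le_pow_right₀ (by linarith) (by omega)
  set β := ⌊N / (3 * K)⌋₊ with hβ
  have hβle : (β : ℝ) ≤ N / (3 * K) := Nat.floor_le (by positivity)
  have hβge : y ^ 8 / 8 ≤ β := by
    have h1 := Nat.lt_floor_add_one (N / (3 * K))
    rw [← hβ] at h1
    have h2 : N / (3 * K) = y ^ 8 / 3 := by rw [hy8]; field_simp
    have h3 : (2:ℝ) ^ 8 ≤ y ^ 8 := by gcongr
    linarith
  have hβ0 : (0:ℝ) < β := lt_of_lt_of_le (by positivity) hβge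
  have hβ0' : 0 < β := by exact_mod_cast hβ0
  set κ := (8 * π) ^ (2 * K) / y ^ (7 * K + 8) with hκ
  have hκ0 : 0 < κ := by positivity
  obtain ⟨L, hL, h, H, htail, hAN⟩ := hA κ hκ0
  have hmain := main_bound hL H hν hE hR hER hρ hK hβ0' (M K) (hM K) hMK
    (T := (y ^ K)⁻¹) (V := 2 * (8 * π) ^ (2 * K) / y ^ (7 * K + 8)) (by positivity) (by positivity) (by
      have h1 : (π / β) ^ (2 * K) * (M K).toReal ≤ κ := by
        have h2 : π / β ≤ 8 * π / y ^ 8 := by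
          rw [div_le_div_iff₀ hβ0 (by positivity)]
          have := mul_le_mul_of_nonneg_left hβge Real.pi_pos.le
          linarith
        have h3 : (M K).toReal ≤ y ^ (9 * K) / y ^ 8 := by
          rw [le_div_iff₀ (by positivity)]; exact hMy
        calc (π / β) ^ (2 * K) * (M K).toReal ≤ (8 * π / y ^ 8) ^ (2 * K) * (y ^ (9 * K) / y ^ 8) := by
              gcongr
          _ = κ := by
              rw [hκ, div_pow, div_mul_div_comm, div_eq_div_iff (by positivity) (by positivity)]
              rw [← pow_mul]
              ring
      have h5 : 2 * (8 * π) ^ (2 * K) / y ^ (7 * K + 8) = κ + κ := by rw [hκ]; ring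
      rw [h5]
      linarith)
  have hfin := hmain.trans (hnum y (hy10.trans hyy1) K β hK hβge)
  have hsub : A N ⊆ {ω | ∀ j < 3 * (K * β * L), 0 < h j ω} := by
    have := hAN N (3 * K * β) (by
      push_cast
      rw [le_div_iff₀ (by positivity)] at hβle
      linarith)
    have e : 3 * K * β * L = 3 * (K * β * L) := by ring
    rwa [e] at this
  have hP := (measureReal_mono hsub (measure_ne_top P _)).trans hfin
  have hlog := (Real.log_le_iff_le_exp (hpos N)).2 hP
  refine hlog.trans ?_
  have hl1 : Real.log (1 / y1 ^ 8 * N / K) ≤ 8 * Real.log y := by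
    have : 8 * Real.log y = Real.log (N / K) := by
      rw [← hy8, Real.log_pow]; norm_num
    rw [this]
    apply Real.log_le_log (by positivity)
    rw [mul_div_assoc]
    apply mul_le_of_le_one_left hxpos.le
    rw [div_le_one (by positivity)]
    exact one_le_pow₀ (by linarith)
  have hKy : (K:ℝ) * y ^ 8 = N := by rw [hy8]; field_simp
  rw [hKy]
  have := mul_le_mul_of_nonneg_left hl1 (by positivity : 0 ≤ C / 8 * N * K)
  linarith

lemma analytic_zero {F : ℝ → ℝ} (hF : ∀ x, AnalyticAt ℝ F x) {E : Set ℝ}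
    (hEb : Bornology.IsBounded E) (hEv : 0 < volume E) (hz : volume (E ∩ {x | F x ≠ 0}) = 0) :
    ∀ x, F x = 0 := by
  set Z := E ∩ {x | F x = 0} with hZ
  have hZv : 0 < volume Z := by
    have : volume E ≤ volume Z + volume (E ∩ {x | F x ≠ 0}) := by
      refine (measure_mono ?_).trans (measure_union_le _ _)
      intro x hx
      by_cases h : F x = 0
      · exact Or.inl ⟨hx, h⟩
      · exact Or.inr ⟨hx, h⟩
    rw [hz, add_zero] at this
    exact hEv.trans_le this
  have hinf : Z.Infinite := by
    intro hfin
    exact hZv.ne' (hfin.measure_zero _)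
  obtain ⟨x0, -, hx0⟩ := hinf.exists_accPt_of_subset_isCompact hEb.isCompact_closure
    (inter_subset_left.trans subset_closure)
  have hfr : ∃ᶠ x in nhdsWithin x0 {x0}ᶜ, F x = 0 := by
    rw [accPt_iff_frequently_nhdsNE] at hx0
    exact hx0.mono fun x hx => hx.2
  have hA : AnalyticOnNhd ℝ F univ := fun x _ => hF x
  have := hA.eqOn_zero_of_preconnected_of_frequently_eq_zero isPreconnected_univ (mem_univ x0) hfr
  exact fun x => this (mem_univ x)

section lemA
variable {K' : Set ℝ}

def cK (K' : Set ℝ) : C(ℝ, C(K', ℝ)) :=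
  ContinuousMap.curry ⟨fun p : ℝ × K' => cos (p.1 * p.2), by fun_prop⟩

def sK (K' : Set ℝ) : C(ℝ, C(K', ℝ)) :=
  ContinuousMap.curry ⟨fun p : ℝ × K' => sin (p.1 * p.2), by fun_prop⟩

lemma cK_apply (l : ℝ) (t : K') : cK K' l t = cos (l * t) := rfl
lemma sK_apply (l : ℝ) (t : K') : sK K' l t = sin (l * t) := rfl

lemma cK_analytic [CompactSpace K'] (Λ : C(K', ℝ) →L[ℝ] ℝ) (x : ℝ) :
    AnalyticAt ℝ (fun l => Λ (cK K' l)) x := by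
  let b : C(K', ℂ) := ⟨fun t => (t : ℝ) * Complex.I, by fun_prop⟩
  let re : C(K', ℂ) →L[ℝ] C(K', ℝ) := ContinuousLinearMap.compLeftContinuous ℝ K' Complex.reCLM
  have e : (fun l => Λ (cK K' l)) = fun l : ℝ => (Λ.comp re) (NormedSpace.exp (l • b)) := by
    funext l
    simp only [ContinuousLinearMap.comp_apply]
    congr 1
    ext t
    have h1 : (NormedSpace.exp (l • b)) t = Complex.exp (l * (t * Complex.I)) := by
      have := NormedSpace.map_exp (ContinuousMap.evalAlgHom ℂ ℂ t) (continuous_eval_const (F := C(K', ℂ)) t) (l • b)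
      simp only [ContinuousMap.evalAlgHom_apply] at this
      rw [this, ← Complex.exp_eq_exp_ℂ]
      simp [b]
    have h2 : re (NormedSpace.exp (l • b)) t = ((NormedSpace.exp (l • b)) t).re := rfl
    rw [h2, h1, cK_apply]
    have : (l : ℂ) * (t * Complex.I) = ((l * t : ℝ) : ℂ) * Complex.I := by push_cast; ring
    rw [this, Complex.exp_ofReal_mul_I_re]
  rw [e]
  have h1 : AnalyticAt ℝ (fun l : ℝ => l • b) x := by fun_prop
  have h2 : AnalyticAt ℝ (NormedSpace.exp : C(K', ℂ) → C(K', ℂ)) (x • b) := NormedSpace.exp_analytic _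
  have h3 := AnalyticAt.comp_of_eq (g := (NormedSpace.exp : C(K', ℂ) → C(K', ℂ))) h2 h1 rfl
  exact ((Λ.comp re).analyticAt _).comp h3

lemma lemA [CompactSpace K'] {ρ : Measure ℝ} [IsFiniteMeasure ρ]
    {ν : ℝ} (hν : 0 < ν) {E : Set ℝ} (hEb : Bornology.IsBounded E)
    (hEv : 0 < volume E)
    (hρ : ∀ A : Set ℝ, MeasurableSet A → ENNReal.ofReal ν * volume (A ∩ E) ≤ ρ A) :
    ∃ (s : Finset K') (a : K' → ℝ), ∀ t : K',
      1 / 2 ≤ ∑ u ∈ s, a u * ∫ l, cos (l * ((t:ℝ) - u)) ∂ρ := by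
  have hI : ∀ (g k : ℝ → ℝ), Continuous g → Continuous k → ∀ B, (∀ l, |g l| ≤ B) → (∀ l, |k l| ≤ B) →
      Integrable (fun l => g l • cK K' l + k l • sK K' l) ρ := by
    intro g k hg hk B h1 h2
    refine Integrable.of_bound (((hg.smul (cK K').continuous).add
      (hk.smul (sK K').continuous)).aestronglyMeasurable) (B + B)
      (Filter.Eventually.of_forall fun l => ?_)
    have hB0 : 0 ≤ B := (abs_nonneg _).trans (h1 l)
    rw [ContinuousMap.norm_le _ (by positivity)]
    intro t
    simp only [ContinuousMap.add_apply, ContinuousMap.smul_apply, smul_eq_mul, cK_apply, sK_apply]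
    refine (norm_add_le _ _).trans (add_le_add ?_ ?_)
    · rw [norm_mul]
      exact (mul_le_of_le_one_right (abs_nonneg _) (abs_cos_le_one _)).trans (h1 l)
    · rw [norm_mul]
      exact (mul_le_of_le_one_right (abs_nonneg _) (abs_sin_le_one _)).trans (h2 l)
  let r : K' → C(K', ℝ) := fun u => ∫ l, (cos (l * u) • cK K' l + sin (l * u) • sK K' l) ∂ρ
  have hrI : ∀ u : K', Integrable (fun l => cos (l * u) • cK K' l + sin (l * u) • sK K' l) ρ := fun u =>
    hI _ _ (by fun_prop) (by fun_prop) 1 (fun _ => abs_cos_le_one _) (fun _ => abs_sin_le_one _)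
  have hr : ∀ u t : K', r u t = ∫ l, cos (l * ((t:ℝ) - u)) ∂ρ := by
    intro u t
    have := (ContinuousMap.evalCLM ℝ t).integral_comp_comm (hrI u)
    change ContinuousMap.evalCLM ℝ t (r u) = _
    rw [← this]
    refine integral_congr_ae (Filter.Eventually.of_forall fun l => ?_)
    simp only [ContinuousMap.evalCLM_apply, ContinuousMap.add_apply, ContinuousMap.smul_apply, cK_apply, sK_apply, smul_eq_mul]
    rw [mul_sub, Real.cos_sub]; ring
  set W := Submodule.span ℝ (range r) with hW
  by_cases hdis : Disjoint (Metric.ball (1 : C(K', ℝ)) (1/2)) (W : Set C(K', ℝ))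
  · exfalso
    obtain ⟨Λ, u0, h1, h2⟩ := geometric_hahn_banach_open (convex_ball _ _) Metric.isOpen_ball W.convex hdis
    have hu0 : u0 ≤ 0 := by simpa using h2 0 W.zero_mem
    have hΛ1 : Λ 1 < 0 := (h1 1 (Metric.mem_ball_self (by norm_num))).trans_le hu0
    have hΛW : ∀ w ∈ W, Λ w = 0 := by
      intro w hw
      by_contra hne
      have h3 := h2 (((u0 - 1) / Λ w) • w) (W.smul_mem _ hw)
      rw [map_smul, smul_eq_mul, div_mul_cancel₀ _ hne] at h3
      linarith
    set F := fun l => Λ (cK K' l) with hF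
    set G := fun l => Λ (sK K' l) with hG
    have hFc : Continuous F := Λ.continuous.comp (cK K').continuous
    have hGc : Continuous G := Λ.continuous.comp (sK K').continuous
    have hFb : ∀ l, |F l| ≤ ‖Λ‖ := by
      intro l
      refine (Λ.le_opNorm _).trans (mul_le_of_le_one_right (norm_nonneg _) ?_)
      rw [ContinuousMap.norm_le _ zero_le_one]
      exact fun t => abs_cos_le_one _
    have hGb : ∀ l, |G l| ≤ ‖Λ‖ := by
      intro l
      refine (Λ.le_opNorm _).trans (mul_le_of_le_one_right (norm_nonneg _) ?_)
      rw [ContinuousMap.norm_le _ zero_le_one]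
      exact fun t => abs_sin_le_one _
    have hvI := hI F G hFc hGc ‖Λ‖ hFb hGb
    have hv0 : ∫ l, (F l • cK K' l + G l • sK K' l) ∂ρ = 0 := by
      ext t
      have := (ContinuousMap.evalCLM ℝ t).integral_comp_comm hvI
      change ContinuousMap.evalCLM ℝ t _ = _
      rw [← this, ContinuousMap.zero_apply, ← hΛW (r t) (Submodule.subset_span (mem_range_self t))]
      change _ = Λ (∫ l, (cos (l * t) • cK K' l + sin (l * t) • sK K' l) ∂ρ)
      rw [← Λ.integral_comp_comm (hrI t)]
      refine integral_congr_ae (Filter.Eventually.of_forall fun l => ?_)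
      simp only [ContinuousMap.evalCLM_apply, ContinuousMap.add_apply, ContinuousMap.smul_apply, cK_apply, sK_apply, smul_eq_mul, map_add, map_smul, F, G]
      ring
    have hsq : ∫ l, (F l ^ 2 + G l ^ 2) ∂ρ = 0 := by
      have h3 := Λ.integral_comp_comm hvI
      rw [hv0, map_zero] at h3
      rw [← h3]
      refine integral_congr_ae (Filter.Eventually.of_forall fun l => ?_)
      simp only [map_add, map_smul, smul_eq_mul, F, G]
      ring
    have hsqI : Integrable (fun l => F l ^ 2 + G l ^ 2) ρ := by
      have h3 := Λ.integrable_comp hvI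
      refine h3.congr (Filter.Eventually.of_forall fun l => ?_)
      simp only [map_add, map_smul, smul_eq_mul, F, G]
      ring
    rw [integral_eq_zero_iff_of_nonneg (fun l => by positivity) hsqI] at hsq
    have hF0 : ρ {l | F l ≠ 0} = 0 := by
      refine measure_mono_null ?_ (ae_iff.1 hsq)
      intro l hl hcon
      apply hl
      simp only [Pi.zero_apply] at hcon
      nlinarith [sq_nonneg (F l), sq_nonneg (G l)]
    have hms : MeasurableSet {l | F l ≠ 0} := (hFc.measurable (measurableSet_singleton 0)).compl
    have h4 := hρ _ hms
    rw [hF0, nonpos_iff_eq_zero, mul_eq_zero, or_iff_right (by simpa using hν), inter_comm] at h4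
    have h5 := analytic_zero (fun x => cK_analytic Λ x) hEb hEv h4 0
    have h6 : cK K' 0 = 1 := by ext t; simp [cK_apply]
    rw [h6] at h5
    linarith
  · rw [Set.not_disjoint_iff] at hdis
    obtain ⟨w, hw1, hw2⟩ := hdis
    rw [SetLike.mem_coe, hW, Finsupp.mem_span_range_iff_exists_finsupp] at hw2
    obtain ⟨a, rfl⟩ := hw2
    refine ⟨a.support, a, fun t => ?_⟩
    have h1 : ‖(a.sum fun i c => c • r i) - 1‖ < 1 / 2 := by simpa [dist_eq_norm] using hw1
    have h2 := (ContinuousMap.norm_coe_le_norm _ t).trans h1.le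
    have h3 : ((a.sum fun i c => c • r i) - 1) t = (∑ u ∈ a.support, a u * ∫ l, cos (l * ((t:ℝ) - u)) ∂ρ) - 1 := by
      simp [Finsupp.sum, hr]
    rw [h3, Real.norm_eq_abs] at h2
    have := (abs_le.1 h2).1
    linarith
end lemA

lemma HG.gp {Ω ι : Type*} [MeasurableSpace Ω] {ρ : Measure ℝ} {P : Measure Ω}
    {h : ι → Ω → ℝ} {τ : ι → ℝ} (H : HG ρ P h τ) : IsGaussianProcess h P := by
  classical
  have hm := H.meas
  refine ⟨fun I => ⟨isGaussian_of_map_eq_gaussianReal fun L => ?_⟩⟩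
  let a : ι → ℝ := fun i => if hi : i ∈ I then L (Pi.single ⟨i, hi⟩ 1) else 0
  have hmI : Measurable (fun ω => I.restrict (fun t => h t ω)) := by
    refine measurable_pi_lambda _ fun i => ?_
    exact hm _
  refine ⟨0, (∫ l, qf τ I a l ∂ρ).toNNReal, ?_⟩
  · rw [Measure.map_map (by fun_prop) hmI, ← H.law I a]
    congr 1
    ext ω
    simp only [Function.comp]
    refine (LinearMap.pi_apply_eq_sum_univ L.toLinearMap _).trans ?_
    rw [← Finset.sum_coe_sort I]
    refine Finset.sum_congr rfl fun i _ => ?_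
    simp only [a, Finset.restrict, smul_eq_mul, Finset.coe_mem, dif_pos, ContinuousLinearMap.coe_coe]
    rw [mul_comm]
    congr 2
    ext j
    simp [Pi.single_apply, eq_comm]

lemma gp_lincomb {Ω S T : Type*} [MeasurableSpace Ω] {P : Measure Ω}
    {X : T → Ω → ℝ} {Y : S → Ω → ℝ} (hX : IsGaussianProcess X P)
    (hY : ∀ s, ∃ (I : Finset T) (c : T → ℝ), ∀ ω, Y s ω = ∑ t ∈ I, c t * X t ω) :
    IsGaussianProcess Y P := by
  refine hX.of_isGaussianProcess fun s => ?_
  obtain ⟨I, c, hc⟩ := hY s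
  refine ⟨I, ∑ t : I, (c t) • ContinuousLinearMap.proj (R := ℝ) (φ := fun _ : I => ℝ) t, fun ω => ?_⟩
  rw [hc]
  simp only [ContinuousLinearMap.sum_apply, ContinuousLinearMap.smul_apply, ContinuousLinearMap.proj_apply,
    smul_eq_mul, Finset.restrict]
  rw [Finset.sum_coe_sort I (fun t => c t * X t ω)]

lemma HG.var {Ω ι : Type*} [MeasurableSpace Ω] {ρ : Measure ℝ} {P : Measure Ω}
    {h : ι → Ω → ℝ} {τ : ι → ℝ} (H : HG ρ P h τ) (s : Finset ι) (a : ι → ℝ) :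
    Var[fun ω => ∑ j ∈ s, a j * h j ω; P] = ∫ l, qf τ s a l ∂ρ := by
  have hm := H.meas
  have h1 : AEMeasurable (fun ω => ∑ j ∈ s, a j * h j ω) P := by fun_prop
  have := variance_map (X := id) (μ := P) (Y := fun ω => ∑ j ∈ s, a j * h j ω) (by fun_prop) h1
  rw [H.law, variance_id_gaussianReal] at this
  have e : (id ∘ fun ω => ∑ j ∈ s, a j * h j ω) = fun ω => ∑ j ∈ s, a j * h j ω := rfl
  rw [e] at this
  rw [← this, Real.coe_toNNReal]
  exact integral_nonneg fun l => qf_nonneg _ _ _ _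

lemma HG.memLp {Ω ι : Type*} [MeasurableSpace Ω] {ρ : Measure ℝ} {P : Measure Ω}
    {h : ι → Ω → ℝ} {τ : ι → ℝ} (H : HG ρ P h τ) (i : ι) : MemLp (h i) 2 P :=
  (H.gp.hasGaussianLaw_eval i).memLp_two

lemma HG.cov {Ω ι : Type*} [MeasurableSpace Ω] {ρ : Measure ℝ} [IsFiniteMeasure ρ]
    {P : Measure Ω} [IsProbabilityMeasure P]
    {h : ι → Ω → ℝ} {τ : ι → ℝ} (H : HG ρ P h τ) (i j : ι) :
    cov[h i, h j; P] = ∫ l, cos (l * (τ i - τ j)) ∂ρ := by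
  classical
  have v1 : ∀ i, Var[h i; P] = ∫ l, cos (l * (τ i - τ i)) ∂ρ := by
    intro i
    have := H.var {i} (fun _ => 1)
    rw [qf_integral] at this
    simpa using this
  by_cases hij : i = j
  · subst hij
    rw [covariance_self (H.meas i).aemeasurable, v1]
  · have := H.var {i, j} (fun _ => 1)
    rw [qf_integral] at this
    simp only [Finset.sum_pair hij, one_mul] at this
    rw [variance_fun_add (H.memLp i) (H.memLp j), v1, v1] at this
    have e : ∫ l, cos (l * (τ j - τ i)) ∂ρ = ∫ l, cos (l * (τ i - τ j)) ∂ρ := by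
      congr 1; ext l; rw [← cos_neg]; congr 1; ring
    rw [e] at this
    linarith

lemma lemB {Ω ι : Type*} [MeasurableSpace Ω] {ρ : Measure ℝ} [IsFiniteMeasure ρ]
    {P : Measure Ω} [IsProbabilityMeasure P]
    {h : ι → Ω → ℝ} {τ : ι → ℝ} (H : HG ρ P h τ) (s : Finset ι) (a : ι → ℝ)
    (hψ : ∀ t, 1 / 2 ≤ ∑ u ∈ s, a u * ∫ l, cos (l * (τ t - τ u)) ∂ρ)
    (D : Set ι) (hD : D.Countable) (hbd : ∀ᵐ ω ∂P, ∃ B : ℝ, ∀ d ∈ D, |h d ω| ≤ B) :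
    0 < P {ω | ∀ d ∈ D, 1 ≤ h d ω} := by
  classical
  rcases D.eq_empty_or_nonempty with rfl | ⟨d₀, hd₀⟩
  · simp
  have hm := H.meas
  set ψ : ι → ℝ := fun t => ∑ u ∈ s, a u * ∫ l, cos (l * (τ t - τ u)) ∂ρ with hψd
  set X : Ω → ℝ := fun ω => ∑ u ∈ s, a u * h u ω with hX
  have hXm : Measurable X := by fun_prop
  set V : ℝ := ∫ l, qf τ s a l ∂ρ with hV
  have hVX : Var[X; P] = V := H.var s a
  have hXL : MemLp X 2 P := memLp_finset_sum _ fun u _ => (H.memLp u).const_mul _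
  have hcov : ∀ t, cov[h t, X; P] = ψ t := by
    intro t
    rw [hX, covariance_fun_sum_right' (fun u _ => (H.memLp u).const_mul _) (H.memLp t)]
    refine Finset.sum_congr rfl fun u _ => ?_
    rw [covariance_const_mul_right, H.cov]
  have hlaw : P.map X = gaussianReal 0 V.toNNReal := H.law s a
  have hVpos : 0 < V := by
    rcases (integral_nonneg (fun l => qf_nonneg τ s a l) : 0 ≤ V).lt_or_eq with h0 | h0
    · exact h0
    · exfalso
      have h0 : 0 = V := h0
      rw [← h0] at hVX
      have h1 := hψ d₀
      have h2 : |cov[h d₀, X; P]| ^ 2 ≤ Var[h d₀; P] * Var[X; P] := by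
        have hae : X =ᵐ[P] fun _ => P[X] := by
          have h9 : eVar[X; P] = 0 := by
            rw [← hXL.ofReal_variance_eq, hVX]; simp
          exact (evariance_eq_zero_iff hXm.aemeasurable).1 h9
        have : cov[h d₀, X; P] = 0 := by
          unfold covariance
          rw [← integral_zero Ω ℝ]
          refine integral_congr_ae ?_
          filter_upwards [hae] with ω hω
          rw [hω]; simp
        rw [this, hVX]; simp
      rw [hVX, mul_zero, hcov] at h2
      have h3 : ψ d₀ = 0 := by
        have := sq_nonneg |ψ d₀|
        have h4 : |ψ d₀| ^ 2 = 0 := le_antisymm h2 this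
        simpa using h4
      have : (1:ℝ)/2 ≤ ψ d₀ := h1
      linarith
  set Y : ι → Ω → ℝ := fun d ω => h d ω - ψ d / V * X ω with hY
  have hYm : ∀ d, Measurable (Y d) := fun d => by fun_prop
  have hGP : IsGaussianProcess (Sum.elim (fun _ : Unit => X) Y) P := by
    refine gp_lincomb H.gp ?_
    rintro (u | d)
    · exact ⟨s, a, fun ω => rfl⟩
    · refine ⟨insert d s, fun t => (if t = d then 1 else 0) - ψ d / V * (if t ∈ s then a t else 0), fun ω => ?_⟩
      simp only [Sum.elim_inr, hY, hX]
      simp only [sub_mul, Finset.sum_sub_distrib, ite_mul, one_mul, zero_mul, Finset.sum_ite_eq',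
        Finset.mem_insert_self, if_true, mul_assoc]
      rw [← Finset.mul_sum]
      congr 2
      rw [← Finset.sum_filter]
      refine Finset.sum_congr ?_ fun _ _ => rfl
      ext t; simp only [Finset.mem_filter, Finset.mem_insert]; tauto
  have hind : IndepFun (fun ω (_ : Unit) => X ω) (fun ω d => Y d ω) P := by
    refine hGP.indepFun_of_covariance_eq_zero (fun _ => hXm.aemeasurable) (fun d => (hYm d).aemeasurable) ?_
    intro _ d
    simp only [hY]
    rw [covariance_fun_sub_right hXL (H.memLp d) (hXL.const_mul _), covariance_const_mul_right,
      covariance_self hXm.aemeasurable, covariance_comm, hcov, hVX]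
    field_simp; ring
  have hψb : ∃ R, ∀ d, |ψ d| ≤ R := by
    refine ⟨∑ u ∈ s, |a u| * ρ.real univ, fun d => ?_⟩
    refine (Finset.abs_sum_le_sum_abs _ _).trans (Finset.sum_le_sum fun u _ => ?_)
    rw [abs_mul]
    refine mul_le_mul_of_nonneg_left ?_ (abs_nonneg _)
    have := norm_integral_le_of_norm_le_const (μ := ρ) (f := fun l => cos (l * (τ d - τ u))) (C := 1)
      (Filter.Eventually.of_forall fun l => by simpa using abs_cos_le_one _)
    simpa using this
  obtain ⟨R, hR⟩ := hψb
  let S : ℕ → Set (ι → ℝ) := fun B => ⋂ d ∈ D, {y | |y d| ≤ B}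
  have hSm : ∀ B, MeasurableSet (S B) := fun B => MeasurableSet.biInter hD fun d _ =>
    measurableSet_le (by fun_prop) measurable_const
  have hB : ∃ B : ℕ, 0 < P ((fun ω d => Y d ω) ⁻¹' S B) := by
    by_contra hcon
    push Not at hcon
    have h1 : P (⋃ B : ℕ, (fun ω d => Y d ω) ⁻¹' S B) = 0 :=
      measure_iUnion_null fun B => le_antisymm (hcon B) bot_le
    have h2 : ∀ᵐ ω ∂P, ω ∈ (⋃ B : ℕ, (fun ω d => Y d ω) ⁻¹' S B) := by
      filter_upwards [hbd] with ω hω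
      obtain ⟨B, hB⟩ := hω
      obtain ⟨n, hn⟩ := exists_nat_ge (B + R / V * |X ω|)
      refine mem_iUnion.2 ⟨n, ?_⟩
      simp only [S, mem_preimage, mem_iInter]
      intro d hd
      change |h d ω - ψ d / V * X ω| ≤ n
      refine (abs_sub _ _).trans (le_trans (add_le_add (hB d hd) ?_) hn)
      rw [abs_mul, abs_div, abs_of_pos hVpos]
      have := hR d
      gcongr
    have h3 : ∀ᵐ ω ∂P, ω ∉ (⋃ B : ℕ, (fun ω d => Y d ω) ⁻¹' S B) := measure_eq_zero_iff_ae_notMem.1 h1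
    have : ∀ᵐ ω ∂P, False := by
      filter_upwards [h2, h3] with ω a b using b a
    simp at this
    exact IsProbabilityMeasure.ne_zero P (by simpa using this)
  obtain ⟨B, hB⟩ := hB
  let x : ℝ := 2 * V * (1 + B)
  have hXpos : 0 < P ((fun ω (_ : Unit) => X ω) ⁻¹' {y | x ≤ y ()}) := by
    have e : ((fun ω (_ : Unit) => X ω) ⁻¹' {y | x ≤ y ()}) = X ⁻¹' (Ici x) := rfl
    rw [e, ← Measure.map_apply hXm measurableSet_Ici, hlaw, pos_iff_ne_zero]
    intro h0
    have := gaussianReal_absolutelyContinuous' 0 (v := V.toNNReal) (by simpa using hVpos) h0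
    simp at this
  have := hind.measure_inter_preimage_eq_mul {y | x ≤ y ()} (S B)
    (measurableSet_le measurable_const (by fun_prop)) (hSm B)
  refine lt_of_lt_of_le (ENNReal.mul_pos hXpos.ne' hB.ne') (this ▸ measure_mono ?_)
  rintro ω ⟨h1, h2⟩ d hd
  simp only [S, mem_preimage, mem_iInter] at h2
  have h3 : |h d ω - ψ d / V * X ω| ≤ B := h2 d hd
  have h1 : x ≤ X ω := h1
  have h4 : 1 / 2 ≤ ψ d := hψ d
  have h5 : 1 + (B:ℝ) ≤ ψ d / V * X ω := by
    have : 1 + (B:ℝ) = (1/2) / V * x := by simp only [x]; field_simp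
    rw [this]
    have : 0 ≤ x := by positivity
    gcongr
  have := (abs_le.1 h3).1
  linarith

lemma posR {Ω : Type*} [MeasurableSpace Ω] {ρ : Measure ℝ} [IsFiniteMeasure ρ]
    {P : Measure Ω} [IsProbabilityMeasure P] {f : ℝ → Ω → ℝ}
    {ν : ℝ} (hν : 0 < ν) {E : Set ℝ} (hEb : Bornology.IsBounded E)
    (hEv : 0 < volume E)
    (hρ : ∀ A : Set ℝ, MeasurableSet A → ENNReal.ofReal ν * volume (A ∩ E) ≤ ρ A)
    (hm : ∀ t, Measurable (f t)) (hc : ∀ᵐ ω ∂P, Continuous fun t => f t ω)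
    (H : ∀ (n : ℕ) (t a : Fin n → ℝ), P.map (fun ω => ∑ i, a i * f (t i) ω)
      = gaussianReal 0 (∑ i, ∑ j, a i * a j * ∫ l, Real.cos (l * (t i - t j)) ∂ρ).toNNReal)
    (N : ℝ) : 0 < P.real {ω | ∀ t ∈ Set.Ioc (0:ℝ) N, 0 < f t ω} := by
  obtain ⟨s, a, hs⟩ := lemA (K' := Icc (0:ℝ) N) hν hEb hEv hρ
  obtain ⟨D, hD, hDd⟩ := TopologicalSpace.exists_countable_dense (Icc (0:ℝ) N)
  have hG : HG ρ P (fun i : Icc (0:ℝ) N => f i) (fun i => (i:ℝ)) :=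
    HG_of ρ P f (fun t => t) hm H (fun i : Icc (0:ℝ) N => (i:ℝ))
  have hpos := lemB hG s a hs D hD (by
    filter_upwards [hc] with ω hω
    obtain ⟨B, hB⟩ := isCompact_Icc (a := (0:ℝ)) (b := N) |>.exists_bound_of_continuousOn hω.continuousOn
    exact ⟨B, fun d _ => hB d d.2⟩)
  refine ENNReal.toReal_pos (ne_of_gt (lt_of_lt_of_le hpos (measure_mono_ae ?_))) (measure_ne_top _ _)
  filter_upwards [hc] with ω hω
  intro h1 t ht
  have hcl : IsClosed {u : Icc (0:ℝ) N | 1 ≤ f u ω} :=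
    isClosed_le continuous_const (hω.comp continuous_subtype_val)
  have h2 : closure D ⊆ {u : Icc (0:ℝ) N | 1 ≤ f u ω} := hcl.closure_subset_iff.2 fun d hd => h1 d hd
  have h3 : (1:ℝ) ≤ f t ω := h2 (hDd (⟨t, ht.1.le, ht.2⟩ : Icc (0:ℝ) N))
  linarith

lemma posZ {Ω : Type*} [MeasurableSpace Ω] {ρ : Measure ℝ} [IsFiniteMeasure ρ]
    {P : Measure Ω} [IsProbabilityMeasure P] {f : ℤ → Ω → ℝ}
    {ν : ℝ} (hν : 0 < ν) {E : Set ℝ} (hEb : Bornology.IsBounded E)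
    (hEv : 0 < volume E)
    (hρ : ∀ A : Set ℝ, MeasurableSet A → ENNReal.ofReal ν * volume (A ∩ E) ≤ ρ A)
    (hm : ∀ t, Measurable (f t))
    (H : ∀ (n : ℕ) (t : Fin n → ℤ) (a : Fin n → ℝ), P.map (fun ω => ∑ i, a i * f (t i) ω)
      = gaussianReal 0
          (∑ i, ∑ j, a i * a j * ∫ l, Real.cos (l * ((t i : ℝ) - (t j : ℝ))) ∂ρ).toNNReal)
    (N : ℝ) : 0 < P.real {ω | ∀ n : ℤ, 0 < n → (n : ℝ) ≤ N → 0 < f n ω} := by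
  have hfin : ((fun n : ℤ => (n:ℝ)) '' (Icc 1 ⌊N⌋)).Finite := (Set.finite_Icc _ _).image _
  set K' : Set ℝ := (fun n : ℤ => (n:ℝ)) '' (Icc 1 ⌊N⌋) with hK'
  haveI : CompactSpace K' := isCompact_iff_compactSpace.1 hfin.isCompact
  haveI : Finite K' := hfin
  obtain ⟨s, a, hs⟩ := lemA (K' := K') hν hEb hEv hρ
  have hfl : ∀ t : K', ((⌊(t:ℝ)⌋ : ℤ) : ℝ) = t := by
    rintro ⟨_, n, _, rfl⟩; simp
  have hG : HG ρ P (fun i : K' => f ⌊(i:ℝ)⌋) (fun i => ((⌊(i:ℝ)⌋ : ℤ) : ℝ)) :=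
    HG_of ρ P f (fun t : ℤ => (t:ℝ)) hm H (fun i : K' => ⌊(i:ℝ)⌋)
  have hpos := lemB hG s a (by intro t; simp only [hfl]; exact hs t) univ (to_countable _) (by
    refine Filter.Eventually.of_forall fun ω => ?_
    obtain ⟨B, hB⟩ := (Set.finite_range (fun d : K' => |f ⌊(d:ℝ)⌋ ω|)).bddAbove
    exact ⟨B, fun d _ => hB ⟨d, rfl⟩⟩)
  refine ENNReal.toReal_pos (ne_of_gt (lt_of_lt_of_le hpos (measure_mono ?_))) (measure_ne_top _ _)
  intro ω h1 n hn hnN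
  have := h1 (⟨(n:ℝ), n, ⟨by omega, Int.le_floor.2 hnN⟩, rfl⟩ : K') (mem_univ _)
  simp only [Int.floor_intCast] at this
  linarith

lemma tailR (ρ : Measure ℝ) [IsFiniteMeasure ρ] (κ : ℝ) (hκ : 0 < κ) :
    ∃ L : ℕ, 0 < L ∧ ρ.real {l | π * L < |l|} ≤ κ := by
  have h1 : Filter.Tendsto (fun L : ℕ => ρ {l : ℝ | π * L < |l|}) Filter.atTop
      (nhds (ρ (⋂ L : ℕ, {l : ℝ | π * L < |l|}))) := by
    refine tendsto_measure_iInter_atTop (fun L => ?_) ?_ ⟨0, measure_ne_top _ _⟩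
    · exact (measurableSet_lt measurable_const (by fun_prop)).nullMeasurableSet
    · intro i j hij l hl
      have : (i:ℝ) ≤ j := by exact_mod_cast hij
      have := mul_le_mul_of_nonneg_left this Real.pi_pos.le
      exact lt_of_le_of_lt this hl
  have h2 : (⋂ L : ℕ, {l : ℝ | π * L < |l|}) = ∅ := by
    refine eq_empty_of_forall_notMem fun l hl => ?_
    obtain ⟨n, hn⟩ := exists_nat_ge (|l| / π)
    have := mem_iInter.1 hl n
    have h3 : π * n < |l| := this
    rw [div_le_iff₀ Real.pi_pos] at hn
    linarith
  rw [h2, measure_empty] at h1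
  have h3 := (h1.eventually (gt_mem_nhds (ENNReal.ofReal_pos.2 hκ))).and (Filter.eventually_gt_atTop 0)
  obtain ⟨L, hL, hL0⟩ := h3.exists
  exact ⟨L, hL0, ENNReal.toReal_le_of_le_ofReal hκ.le hL.le⟩


/-- **Upper bounds for vanishing spectrum (Corollary 2.6).** Let `f` be a normalized GSP
on `ℤ` or `ℝ` with some finite positive moment and a nontrivial absolutely continuous
spectral component. For `N > 0`, let `k(N)` be the greatest `k ∈ ℕ` with `0 < k ≤ N` and
`k·m_{-2k}^{1/k} ≤ N` (whenever this set is nonempty). Then there are constants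
`C, c > 0` (depending on `ρ`) and `N₀` such that for every `N > N₀` for which `k(N)` is
defined: `log P_f(N) ≤ -C·N·k(N)·log(cN/k(N))`. -/
theorem statement6 :
    (∀ (Ω : Type) (_ : MeasurableSpace Ω) (P : Measure Ω) (ρ : Measure ℝ)
        (f : ℤ → Ω → ℝ), IsGSPZ ρ P f → ρ Set.univ = 1 →
        (∃ δ : ℝ, 0 < δ ∧ specMom ρ δ < ⊤) →
        (∃ (ν : ℝ) (E : Set ℝ), 0 < ν ∧ MeasurableSet E ∧ Bornology.IsBounded E ∧
          0 < volume E ∧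
          ∀ A : Set ℝ, MeasurableSet A → ENNReal.ofReal ν * volume (A ∩ E) ≤ ρ A) →
        ∃ C c N₀ : ℝ, 0 < C ∧ 0 < c ∧ 0 < N₀ ∧
          ∀ N : ℝ, N₀ < N → ∀ K : ℕ,
            IsGreatest {k : ℕ | 0 < k ∧ (k : ℝ) ≤ N ∧ specMom ρ (-(2 * k : ℝ)) < ⊤ ∧
              (k : ℝ) * ((specMom ρ (-(2 * k : ℝ))).toReal) ^ (1 / (k : ℝ)) ≤ N} K →
            Real.log (persZ P f N) ≤ -C * N * K * Real.log (c * N / K)) ∧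
    (∀ (Ω : Type) (_ : MeasurableSpace Ω) (P : Measure Ω) (ρ : Measure ℝ)
        (f : ℝ → Ω → ℝ), IsGSPR ρ P f → ρ Set.univ = 1 →
        (∃ δ : ℝ, 0 < δ ∧ specMom ρ δ < ⊤) →
        (∃ (ν : ℝ) (E : Set ℝ), 0 < ν ∧ MeasurableSet E ∧ Bornology.IsBounded E ∧
          0 < volume E ∧
          ∀ A : Set ℝ, MeasurableSet A → ENNReal.ofReal ν * volume (A ∩ E) ≤ ρ A) →
        ∃ C c N₀ : ℝ, 0 < C ∧ 0 < c ∧ 0 < N₀ ∧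
          ∀ N : ℝ, N₀ < N → ∀ K : ℕ,
            IsGreatest {k : ℕ | 0 < k ∧ (k : ℝ) ≤ N ∧ specMom ρ (-(2 * k : ℝ)) < ⊤ ∧
              (k : ℝ) * ((specMom ρ (-(2 * k : ℝ))).toReal) ^ (1 / (k : ℝ)) ≤ N} K →
            Real.log (persR P f N) ≤ -C * N * K * Real.log (c * N / K)) := by
  constructor
  · rintro Ω _ P ρ f ⟨hfin, -, hsupp, hP, hm, H⟩ - - ⟨ν, E, hν, hE, hEb, hEv, hρ⟩
    obtain ⟨C, c, N₀, hC, hc, hN₀, hmain⟩ := core (P := P) hν hE hEb hEv hρ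
      (fun N => {ω | ∀ n : ℤ, 0 < n → (n : ℝ) ≤ N → 0 < f n ω})
      (fun N => posZ hν hEb hEv hρ hm H N)
      (by
        intro κ hκ
        refine ⟨1, one_pos, fun j => f ((j:ℤ) + 1), ?_, ?_, ?_⟩
        · have := HG_of ρ P f (fun t : ℤ => (t:ℝ)) hm H (fun j : ℕ => (j:ℤ) + 1)
          have e : (fun j : ℕ => ((j:ℝ) + 1) / ((1:ℕ):ℝ)) = fun j : ℕ => (((j:ℤ) + 1 : ℤ) : ℝ) := by
            ext j; simp
          rw [e]; exact this
        · have : ρ {l | π * ((1:ℕ):ℝ) < |l|} = 0 := by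
            refine measure_mono_null ?_ hsupp
            intro l hl hl2
            have h1 : π * ((1:ℕ):ℝ) < |l| := hl
            have h2 := abs_le.2 hl2
            simp at h1
            linarith
          rw [Measure.real, this]; simpa using hκ.le
        · intro N n hn ω hω j hj
          refine hω _ (by omega) (le_trans ?_ hn)
          have : j + 1 ≤ n := by omega
          exact_mod_cast this)
      (fun k => specMom ρ (-(2 * k : ℝ))) (fun k => rfl)
    refine ⟨C, c, N₀, hC, hc, hN₀, fun N hN K hK => ?_⟩
    obtain ⟨h1, h2, h3, h4⟩ := hK.1
    exact hmain N hN K h1 h2 h3 h4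
  · rintro Ω _ P ρ f ⟨hfin, -, hP, hmm, hcont, H⟩ - - ⟨ν, E, hν, hE, hEb, hEv, hρ⟩
    have hm : ∀ t, Measurable (f t) := fun t => hmm.comp measurable_prodMk_left
    obtain ⟨C, c, N₀, hC, hc, hN₀, hmain⟩ := core (P := P) hν hE hEb hEv hρ
      (fun N => {ω | ∀ t ∈ Set.Ioc (0:ℝ) N, 0 < f t ω})
      (fun N => posR hν hEb hEv hρ hm hcont H N)
      (by
        intro κ hκ
        obtain ⟨L, hL, hLκ⟩ := tailR ρ κ hκ
        have hL' : (0:ℝ) < L := by exact_mod_cast hL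
        refine ⟨L, hL, fun j => f (((j:ℝ) + 1) / L), ?_, hLκ, ?_⟩
        · exact HG_of ρ P f (fun t => t) hm H (fun j : ℕ => ((j:ℝ) + 1) / L)
        · intro N n hn ω hω j hj
          refine hω _ ⟨by positivity, le_trans ?_ hn⟩
          rw [div_le_iff₀ hL']
          have : j + 1 ≤ n * L := hj
          exact_mod_cast this)
      (fun k => specMom ρ (-(2 * k : ℝ))) (fun k => rfl)
    refine ⟨C, c, N₀, hC, hc, hN₀, fun N hN K hK => ?_⟩
    obtain ⟨h1, h2, h3, h4⟩ := hK.1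
    exact hmain N hN K h1 h2 h3 h4

end
end

section
/- There exists a universal constant c₀ > 0 such that: for every N > 0, every k ∈ ℕ with k ≤ N, and every k-times differentiable function f : ℝ → ℝ whose k-th derivative satisfies f^{(k)}(t) > 0 for all t ∈ [−N, N], one has (1/N) ∫_{−(9/20)N}^{(9/20)N} f^{(k)}(t) dt ≤ (c₀ k / N)^k · sup_{t ∈ [−N, N]} |f(t)|. -/
open Real Set

lemma aux_bound (h : ℝ) (hh : 0 < h) (f : ℝ → ℝ) (M : ℝ) (n : ℕ) :
    ∀ x : ℝ, (∀ t ∈ Set.Icc x (x + n * h), |f t| ≤ M) →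
      |((fwdDiff h)^[n] f) x| ≤ 2 ^ n * M := by
  induction n with
  | zero => intro x hx; simpa using hx x (by simp)
  | succ n ih =>
    intro x hx
    rw [Function.iterate_succ_apply', fwdDiff]
    have h1 := ih x (fun t ht => hx t ⟨ht.1, by push_cast; linarith [ht.2]⟩)
    have h2 := ih (x + h) (fun t ht => hx t ⟨by linarith [ht.1], by push_cast; linarith [ht.2]⟩)
    rw [abs_le] at *
    rw [pow_succ]
    constructor <;> linarith [h1.1, h1.2, h2.1, h2.2]

lemma aux_iter (h : ℝ) (f : ℝ → ℝ) (n : ℕ)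
    (hf : ∀ i ≤ n, Differentiable ℝ (iteratedDeriv i f)) :
    iteratedDeriv n (fwdDiff h f) = fun t => iteratedDeriv n f (t + h) - iteratedDeriv n f t := by
  have hc : ContDiff ℝ n f := by
    apply contDiff_of_differentiable_iteratedDeriv
    intro m hm
    exact hf m (by exact_mod_cast hm)
  have hc2 : ContDiff ℝ n (fun t => f (t + h)) := hc.comp (by fun_prop)
  funext t
  have := iteratedDeriv_sub (x := t) hc2.contDiffAt hc.contDiffAt
  rw [iteratedDeriv_comp_add_const] at this
  exact this

lemma aux_mvt (h : ℝ) (hh : 0 < h) (n : ℕ) :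
    ∀ (f : ℝ → ℝ) (x : ℝ), (∀ i < n, Differentiable ℝ (iteratedDeriv i f)) →
      ∃ ξ ∈ Set.Icc x (x + n * h), ((fwdDiff h)^[n] f) x = h ^ n * iteratedDeriv n f ξ := by
  induction n with
  | zero => intro f x _; exact ⟨x, by simp, by simp⟩
  | succ n ih =>
    intro f x hf
    rw [Function.iterate_succ_apply]
    obtain ⟨ξ, hξ, e⟩ := ih (fwdDiff h f) x (by
      intro i hi
      rw [aux_iter h f i (fun j hj => hf j (by omega))]
      have := hf i (by omega)
      fun_prop)
    rw [aux_iter h f n (fun j hj => hf j (by omega))] at e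
    have hd := hf n (by omega)
    obtain ⟨η, hη, e2⟩ := exists_deriv_eq_slope (iteratedDeriv n f) (show ξ < ξ + h by linarith)
      hd.continuous.continuousOn hd.differentiableOn
    refine ⟨η, ⟨by linarith [hξ.1, hη.1], by push_cast; linarith [hξ.2, hη.2]⟩, ?_⟩
    rw [e, iteratedDeriv_succ, e2, add_sub_cancel_left, pow_succ]
    field_simp

/-- **Deterministic result (continuous time).**
There is a universal constant `c₀ > 0` such that for every `N > 0`, every `k ∈ ℕ` with
`1 ≤ k ≤ N`, and every `k`-times differentiable `f : ℝ → ℝ` with `f⁽ᵏ⁾ > 0` on `[-N, N]`,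
`(1/N) ∫_{-9N/20}^{9N/20} f⁽ᵏ⁾ ≤ (c₀ k / N)^k · sup_{[-N,N]} |f|`. -/
theorem statement8 :
    ∃ c₀ : ℝ, 0 < c₀ ∧
      ∀ (N : ℝ), 0 < N → ∀ (k : ℕ), 1 ≤ k → (k : ℝ) ≤ N → ∀ f : ℝ → ℝ,
        (∀ i < k, Differentiable ℝ (iteratedDeriv i f)) →
        (∀ t ∈ Set.Icc (-N) N, 0 < iteratedDeriv k f t) →
        (1 / N) * ∫ t in (-(9/20 * N))..(9/20 * N), iteratedDeriv k f t
          ≤ (c₀ * k / N) ^ k * sSup ((fun t => |f t|) '' Set.Icc (-N) N) := by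
  refine ⟨4, by norm_num, ?_⟩
  intro N hN k hk _ f hf hpos
  obtain ⟨n, rfl⟩ : ∃ n, k = n + 1 := ⟨k - 1, by omega⟩
  set M := sSup ((fun t => |f t|) '' Set.Icc (-N) N) with hM
  have hfc : Continuous f := by
    have := (hf 0 (by omega)).continuous
    simpa using this
  have hbd : ∀ t ∈ Set.Icc (-N) N, |f t| ≤ M := fun t ht =>
    le_csSup (isCompact_Icc.image (by fun_prop)).bddAbove ⟨t, ht, rfl⟩
  have hM0 : 0 ≤ M := (abs_nonneg _).trans (hbd 0 ⟨by linarith, by linarith⟩)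
  set g := iteratedDeriv n f with hg
  have hgd : Differentiable ℝ g := hf n (by omega)
  have hder : ∀ t, HasDerivAt g (iteratedDeriv (n+1) f t) t := fun t => by
    rw [iteratedDeriv_succ]; exact (hgd t).hasDerivAt
  have hint : ∫ t in (-(9/20 * N))..(9/20 * N), iteratedDeriv (n+1) f t
      = g (9/20*N) - g (-(9/20*N)) := by
    apply intervalIntegral.integral_eq_sub_of_hasDerivAt (fun t _ => hder t)
    apply intervalIntegral.intervalIntegrable_deriv_of_nonneg hgd.continuous.continuousOn
      (fun t _ => hder t)
    intro t ht
    rw [min_eq_left (by linarith), max_eq_right (by linarith)] at ht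
    exact (hpos t ⟨by linarith [ht.1], by linarith [ht.2]⟩).le
  have hmono : MonotoneOn g (Set.Icc (-N) N) := by
    apply monotoneOn_of_deriv_nonneg (convex_Icc _ _) hgd.continuous.continuousOn
      hgd.differentiableOn
    intro t ht
    rw [(hder t).deriv]
    exact (hpos t (interior_subset ht)).le
  have hn : (0:ℝ) < (n:ℝ) + 1 := by positivity
  set h := N / (2 * ((n:ℝ) + 1)) with hh
  have hh0 : 0 < h := by positivity
  have hnh : n * h ≤ N / 2 := by
    have : ((n:ℝ) + 1) * h = N / 2 := by rw [hh]; field_simp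
    linarith
  have hnh0 : 0 ≤ n * h := by positivity
  obtain ⟨ξ, hξ, e1⟩ := aux_mvt h hh0 n f (9/20*N) (fun i hi => hf i (by omega))
  obtain ⟨η, hη, e2⟩ := aux_mvt h hh0 n f (-N) (fun i hi => hf i (by omega))
  have b1 := aux_bound h hh0 f M n (9/20*N)
    (fun t ht => hbd t ⟨by linarith [ht.1], by linarith [ht.2]⟩)
  have b2 := aux_bound h hh0 f M n (-N)
    (fun t ht => hbd t ⟨by linarith [ht.1], by linarith [ht.2]⟩)
  rw [e1] at b1
  rw [e2] at b2
  have m1 : g (9/20*N) ≤ g ξ := hmono ⟨by linarith, by linarith⟩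
    ⟨by linarith [hξ.1], by linarith [hξ.2]⟩ hξ.1
  have m2 : g η ≤ g (-(9/20*N)) := hmono ⟨by linarith [hη.1], by linarith [hη.2]⟩
    ⟨by linarith, by linarith⟩ (by linarith [hη.2])
  have hp : 0 < h ^ n := by positivity
  have key : h ^ n * (g (9/20*N) - g (-(9/20*N))) ≤ 2 * (2 ^ n * M) := by
    have := mul_le_mul_of_nonneg_left (show g (9/20*N) - g (-(9/20*N)) ≤ g ξ - g η by linarith) hp.le
    linarith [(abs_le.1 b1).2, (abs_le.1 b2).1]
  rw [hint]
  have hq : (4 * ((n + 1 : ℕ) : ℝ) / N) = 2 / h := by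
    rw [hh]; push_cast; field_simp; norm_num
  have hN2 : N = h * (2 * ((n:ℝ) + 1)) := by rw [hh]; field_simp
  rw [hq, div_pow]
  have key2 : g (9/20*N) - g (-(9/20*N)) ≤ 2 * (2 ^ n * M) / h ^ n := by
    rw [le_div_iff₀ hp]; linarith
  calc 1 / N * (g (9/20*N) - g (-(9/20*N))) ≤ 1 / N * (2 * (2 ^ n * M) / h ^ n) := by gcongr
    _ = 2 ^ (n+1) / h ^ (n+1) * M * (1 / (2 * ((n:ℝ)+1))) := by
      rw [show 1 / N = 1 / (h * (2 * ((n:ℝ) + 1))) by rw [← hN2]]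
      field_simp
      ring
    _ ≤ 2 ^ (n+1) / h ^ (n+1) * M * 1 := by
      gcongr
      rw [div_le_one (by positivity)]
      have : (0:ℝ) ≤ n := by positivity
      linarith
    _ = _ := by ring
end

section
/- There exists a universal constant c > 0 such that: for every k, N ∈ ℕ with N ≥ k, and every function f : ℤ → ℝ such that the k-th discrete derivative satisfies Δ^k f(n) > 0 for all integers n ∈ [−N, N] and (1/N) · Σ_{n ∈ [−(9/10)N, (9/10)N] ∩ ℤ} Δ^k f(n) ≥ k!/N^k, one has sup_{n ∈ [−2N, 2N] ∩ ℤ} |f(n)| ≥ 1/c^k. -/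
open Real Set

/-- The discrete derivative `(Δf)(n) = f(n+1) - f(n)` of a function `f : ℤ → ℝ`. -/
def discDeriv : (ℤ → ℝ) → (ℤ → ℝ) := fun f n => f (n + 1) - f n

/-- step-`m` difference -/
def stepDiff (m : ℕ) (f : ℤ → ℝ) : ℤ → ℝ := fun n => f (n + m) - f n

/-- window sum of length `m` -/
def winSum (m : ℕ) (f : ℤ → ℝ) : ℤ → ℝ := fun n => ∑ j ∈ Finset.range m, f (n + j)

lemma stepDiff_eq (m : ℕ) (f : ℤ → ℝ) : stepDiff m f = winSum m (discDeriv f) := by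
  funext n
  simp only [stepDiff, winSum, discDeriv]
  have := Finset.sum_range_sub (fun j : ℕ => f (n + j)) m
  simp only [Nat.cast_zero, add_zero] at this
  rw [← this]
  refine Finset.sum_congr rfl fun j _ => ?_
  push_cast
  rw [add_assoc]

lemma winSum_comm (m : ℕ) : Function.Commute (winSum m) discDeriv := by
  intro f
  funext n
  simp only [winSum, discDeriv, Finset.sum_sub_distrib]
  congr 1
  refine Finset.sum_congr rfl fun j _ => ?_
  congr 1
  ring

lemma stepDiff_iter (m k : ℕ) (f : ℤ → ℝ) :
    (stepDiff m)^[k] f = (winSum m)^[k] (discDeriv^[k] f) := by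
  have h : stepDiff m = winSum m ∘ discDeriv := funext (stepDiff_eq m)
  rw [h, (winSum_comm m).comp_iterate]
  rfl

lemma stepDiff_bound (m : ℕ) (a b : ℤ) (k : ℕ) : ∀ (f : ℤ → ℝ) (M : ℝ),
    (∀ n, a ≤ n → n ≤ b + k * m → |f n| ≤ M) →
    ∀ n, a ≤ n → n ≤ b → |(stepDiff m)^[k] f n| ≤ 2 ^ k * M := by
  induction k with
  | zero =>
    intro f M h n h1 h2
    simpa using h n h1 (by simpa using h2)
  | succ k ih =>
    intro f M h n h1 h2
    rw [Function.iterate_succ_apply]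
    have := ih (stepDiff m f) (2 * M) (by
      intro x hx1 hx2
      have e1 := h x hx1 (by push_cast; nlinarith [Int.natCast_nonneg m])
      have e2 := h (x + m) (by linarith [Int.natCast_nonneg m]) (by push_cast; nlinarith)
      simp only [stepDiff]
      have := abs_sub (f (x + m)) (f x)
      linarith) n h1 h2
    rw [pow_succ]
    linarith

lemma winSum_lower (p : ℕ) (a b : ℤ) (k : ℕ) : ∀ (g : ℤ → ℝ),
    (∀ n, a ≤ n → n ≤ b + k * p → 0 ≤ g n) →
    ((p : ℝ) + 1) ^ k * ∑ x ∈ Finset.Icc (a + k * p) b, g x ≤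
      ∑ n ∈ Finset.Icc a b, (winSum (p + 1))^[k] g n := by
  induction k with
  | zero => intro g h; simp
  | succ k ih =>
    intro g h
    simp only [Function.iterate_succ_apply]
    refine le_trans ?_ (ih (winSum (p + 1) g) ?_)
    · rw [pow_succ, mul_assoc]
      refine mul_le_mul_of_nonneg_left ?_ (by positivity)
      simp only [winSum]
      rw [Finset.sum_comm]
      have : ((p : ℝ) + 1) * ∑ x ∈ Finset.Icc (a + (k + 1 : ℕ) * p) b, g x =
        ∑ j ∈ Finset.range (p + 1), ∑ x ∈ Finset.Icc (a + (k + 1 : ℕ) * p) b, g x := by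
        simp
      rw [this]
      refine Finset.sum_le_sum fun j hj => ?_
      have hj' : (j : ℤ) ≤ p := by
        have := Finset.mem_range.1 hj
        omega
      have e : ∑ x ∈ Finset.Icc (a + k * p) b, g (x + j) =
          ∑ y ∈ Finset.Icc (a + k * p + j) (b + j), g y := by
        rw [← Finset.image_add_right_Icc, Finset.sum_image]
        intro x _ y _ hxy
        simpa using hxy
      rw [e]
      have hkp : (0 : ℤ) ≤ k * p := by positivity
      refine Finset.sum_le_sum_of_subset_of_nonneg ?_ ?_
      · intro y hy
        rw [Finset.mem_Icc] at hy ⊢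
        push_cast at hy
        constructor <;> nlinarith
      · intro y hy _
        rw [Finset.mem_Icc] at hy
        refine h y (by linarith) (by push_cast; nlinarith)
    · intro n h1 h2
      refine Finset.sum_nonneg fun j hj => ?_
      have hj' : (j : ℤ) ≤ p := by
        have := Finset.mem_range.1 hj
        omega
      exact h _ (by linarith) (by push_cast; nlinarith)

theorem statement9 :
    ∃ c : ℝ, 0 < c ∧
      ∀ (k N : ℕ), 1 ≤ k → k ≤ N → ∀ f : ℤ → ℝ,
        (∀ n ∈ Finset.Icc (-(N : ℤ)) (N : ℤ), 0 < (discDeriv^[k] f) n) →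
        ((Nat.factorial k : ℝ) / (N : ℝ) ^ k ≤
          (1 / (N : ℝ)) *
            ∑ n ∈ Finset.Icc (⌈-(9 / 10 * (N : ℝ))⌉) (⌊9 / 10 * (N : ℝ)⌋),
              (discDeriv^[k] f) n) →
        ∃ n ∈ Finset.Icc (-(2 * N : ℤ)) (2 * N : ℤ), 1 / c ^ k ≤ |f n| := by
  refine ⟨200, by norm_num, ?_⟩
  intro k N hk hkN f hpos hsum
  by_contra! hcon
  have hN : 1 ≤ N := hk.trans hkN
  have hNr : (1 : ℝ) ≤ N := by exact_mod_cast hN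
  have hkr : (1 : ℝ) ≤ k := by exact_mod_cast hk
  obtain ⟨p, hp⟩ : ∃ p : ℕ, p = N / (10 * k) := ⟨_, rfl⟩
  have hp1 : 10 * (k * p) ≤ N := by
    have := Nat.mul_div_le N (10 * k)
    rw [← hp] at this
    linarith
  have hp2 : N ≤ 10 * k * (p + 1) := by
    have := Nat.lt_mul_div_succ N (b := 10 * k) (by omega)
    rw [← hp] at this
    exact this.le
  set B : ℤ := ⌊9 / 10 * (N : ℝ)⌋ with hB
  set A : ℤ := ⌈-(9 / 10 * (N : ℝ))⌉ with hA
  have hBr : (B : ℝ) ≤ 9 / 10 * N := Int.floor_le _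
  have hB10 : 10 * B ≤ 9 * N := by
    have : (10 * B : ℝ) ≤ 9 * N := by linarith
    exact_mod_cast this
  have hB0 : 0 ≤ B := Int.floor_nonneg.2 (by positivity)
  have hAr : -(9 / 10 * (N : ℝ)) ≤ A := Int.le_ceil _
  have hA10 : -(9 * (N : ℤ)) ≤ 10 * A := by
    have : -(9 * (N : ℝ)) ≤ 10 * A := by linarith
    exact_mod_cast this
  have hp1z : 10 * ((k : ℤ) * p) ≤ N := by exact_mod_cast hp1
  have hkNz : (k : ℤ) ≤ N := by exact_mod_cast hkN
  have h1 := winSum_lower p (-(N : ℤ)) B k (discDeriv^[k] f) (by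
    intro n h1 h2
    exact (hpos n (Finset.mem_Icc.2 ⟨h1, by linarith⟩)).le)
  rw [← stepDiff_iter] at h1
  have h2 : ∑ n ∈ Finset.Icc A B, discDeriv^[k] f n ≤
      ∑ x ∈ Finset.Icc (-(N : ℤ) + k * p) B, discDeriv^[k] f x := by
    refine Finset.sum_le_sum_of_subset_of_nonneg ?_ ?_
    · exact Finset.Icc_subset_Icc_left (by linarith)
    · intro y hy _
      rw [Finset.mem_Icc] at hy
      have : (0 : ℤ) ≤ k * p := by positivity
      exact (hpos y (Finset.mem_Icc.2 ⟨by linarith, by linarith⟩)).le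
  have h3 : ∑ n ∈ Finset.Icc (-(N : ℤ)) B, (stepDiff (p + 1))^[k] f n ≤
      3 * N * (2 ^ k * (1 / 200 ^ k)) := by
    have hb := stepDiff_bound (p + 1) (-(N : ℤ)) B k f (1 / 200 ^ k) (by
      intro n h1 h2
      push_cast at h2
      exact (hcon n (Finset.mem_Icc.2 ⟨by linarith, by linarith⟩)).le)
    have := Finset.sum_le_card_nsmul (Finset.Icc (-(N : ℤ)) B) (fun n => (stepDiff (p + 1))^[k] f n)
      (2 ^ k * (1 / 200 ^ k)) (by
        intro n hn
        rw [Finset.mem_Icc] at hn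
        exact (le_abs_self _).trans (hb n hn.1 hn.2))
    refine this.trans ?_
    rw [nsmul_eq_mul]
    refine mul_le_mul_of_nonneg_right ?_ (by positivity)
    rw [Int.card_Icc]
    have : (B + 1 - -(N : ℤ)).toNat ≤ 3 * N := by omega
    exact_mod_cast this
  have h4 : (N : ℝ) * (k.factorial / (N : ℝ) ^ k) ≤ ∑ n ∈ Finset.Icc A B, discDeriv^[k] f n := by
    have := mul_le_mul_of_nonneg_left hsum (by positivity : (0 : ℝ) ≤ N)
    rwa [← mul_assoc, mul_one_div_cancel (by positivity), one_mul] at this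
  have h5 : ((p : ℝ) + 1) ^ k * (N * (k.factorial / (N : ℝ) ^ k)) ≤
      3 * N * (2 ^ k * (1 / 200 ^ k)) :=
    (mul_le_mul_of_nonneg_left (h4.trans h2) (by positivity)).trans (h1.trans h3)
  have h6 : (N : ℝ) ^ k ≤ 10 ^ k * k ^ k * (p + 1) ^ k := by
    rw [← mul_pow, ← mul_pow]
    refine pow_le_pow_left₀ (by positivity) ?_ k
    exact_mod_cast hp2
  have h7 : (k : ℝ) ^ k ≤ 3 ^ k * k.factorial := by
    have := Real.pow_div_factorial_le_exp (k : ℝ) (by positivity) k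
    rw [div_le_iff₀ (by positivity)] at this
    refine this.trans (mul_le_mul_of_nonneg_right ?_ (by positivity))
    rw [← Real.exp_one_pow]
    exact pow_le_pow_left₀ (by positivity) (by linarith [Real.exp_one_lt_d9]) k
  have h8 : ((p : ℝ) + 1) ^ k * k.factorial * 200 ^ k ≤ 3 * 2 ^ k * N ^ k := by
    have hN0 : (0 : ℝ) < N := by linarith
    have e1 : ((p : ℝ) + 1) ^ k * (N * (k.factorial / (N : ℝ) ^ k)) =
      (N / (N ^ k * 200 ^ k)) * (((p : ℝ) + 1) ^ k * k.factorial * 200 ^ k) := by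
      field_simp
    have e2 : 3 * N * (2 ^ k * (1 / 200 ^ k)) =
      (N / ((N : ℝ) ^ k * 200 ^ k)) * (3 * 2 ^ k * N ^ k) := by
      field_simp
    rw [e1, e2] at h5
    exact le_of_mul_le_mul_left h5 (by positivity)
  have hQ : (0 : ℝ) < ((p : ℝ) + 1) ^ k * k.factorial := by positivity
  have h9 : (N : ℝ) ^ k ≤ 30 ^ k * (((p : ℝ) + 1) ^ k * k.factorial) := by
    refine h6.trans ?_
    have : (30 : ℝ) ^ k = 10 ^ k * 3 ^ k := by rw [← mul_pow]; norm_num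
    rw [this]
    calc (10 : ℝ) ^ k * k ^ k * (p + 1) ^ k ≤ 10 ^ k * (3 ^ k * k.factorial) * (p + 1) ^ k := by
          gcongr
      _ = _ := by ring
  have h10 : (200 : ℝ) ^ k ≤ 3 * 2 ^ k * 30 ^ k := by
    refine le_of_mul_le_mul_left ?_ hQ
    refine h8.trans ?_
    calc (3 : ℝ) * 2 ^ k * N ^ k ≤ 3 * 2 ^ k * (30 ^ k * (((p : ℝ) + 1) ^ k * k.factorial)) := by
          gcongr
      _ = _ := by ring
  have h11 : (3 : ℝ) * 2 ^ k * 30 ^ k ≤ 180 ^ k := by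
    have : (180 : ℝ) ^ k = 3 ^ k * 2 ^ k * 30 ^ k := by rw [← mul_pow, ← mul_pow]; norm_num
    rw [this]
    gcongr
    exact le_self_pow₀ (by norm_num) (by omega)
  have h12 : (180 : ℝ) ^ k < 200 ^ k := pow_lt_pow_left₀ (by norm_num) (by norm_num) (by omega)
  linarith
end

section
/- There exists a universal constant c > 0 such that: for every k ∈ ℕ and every k-times differentiable function f : ℝ → ℝ with inf_{x ∈ [−1,1]} f^{(k)}(x) > 0 and ∫_{−0.9}^{0.9} f^{(k)}(x) dx ≥ k!, one has sup_{x ∈ [−1,1]} |f(x)| ≥ 1/c^k. -/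
open Real Set

lemma fd_aux (m : ℕ) : ∀ (F : ℕ → ℝ → ℝ) (x h A M : ℝ), 0 ≤ h →
    (∀ i < m, ∀ t, HasDerivAt (F i) (F (i+1) t) t) →
    (∀ t ∈ Icc x (x + m * h), A ≤ F m t) →
    (∀ t ∈ Icc x (x + m * h), |F 0 t| ≤ M) → A * h ^ m ≤ 2 ^ m * M := by
  induction m with
  | zero =>
    intro F x h A M hh _ hA hM
    have h1 := hA x (by simp)
    have h2 := hM x (by simp)
    have := le_abs_self (F 0 x)
    simp; linarith
  | succ m ih =>
    intro F x h A M hh hd hA hM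
    have e : ((m + 1 : ℕ) : ℝ) * h = m * h + h := by push_cast; ring
    rw [e] at hA hM
    have key := ih (fun i t => F i (t + h) - F i t) x h (A * h) (2 * M) hh ?_ ?_ ?_
    · calc A * h ^ (m+1) = A * h * h ^ m := by ring
        _ ≤ _ := key
        _ = _ := by ring
    · intro i hi t
      exact ((hd i (by omega) (t + h)).comp_add_const t h).sub (hd i (by omega) t)
    · intro t ht
      have := (convex_Icc t (t + h)).mul_sub_le_image_sub_of_le_deriv (f := F m) (C := A)
        (fun s _ => (hd m (by omega) s).continuousAt.continuousWithinAt)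
        (fun s _ => (hd m (by omega) s).differentiableAt.differentiableWithinAt)
        (fun s hs => by
          rw [interior_Icc] at hs
          rw [(hd m (by omega) s).deriv]
          exact hA s ⟨by linarith [ht.1, hs.1], by linarith [ht.2, hs.2]⟩)
        t ⟨le_rfl, by linarith⟩ (t + h) ⟨by linarith, le_rfl⟩ (by linarith)
      simpa using this
    · intro t ht
      have h1 := abs_le.1 (hM t ⟨ht.1, by linarith [ht.2]⟩)
      have h2 := abs_le.1 (hM (t + h) ⟨by linarith [ht.1], by linarith [ht.2]⟩)
      exact abs_le.2 ⟨by linarith [h1.2, h2.1], by linarith [h1.1, h2.2]⟩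

/-- There is a universal constant `c > 0` such that for every `k ∈ ℕ` and every `k`-times
differentiable `f : ℝ → ℝ` with `inf_{[-1,1]} f⁽ᵏ⁾ > 0` and `∫_{-0.9}^{0.9} f⁽ᵏ⁾ ≥ k!`,
one has `sup_{[-1,1]} |f| ≥ 1/c^k`. -/
theorem statement10 :
    ∃ c : ℝ, 0 < c ∧
      ∀ (k : ℕ), 1 ≤ k → ∀ f : ℝ → ℝ,
        (∀ i < k, Differentiable ℝ (iteratedDeriv i f)) →
        0 < sInf ((iteratedDeriv k f) '' Set.Icc (-1 : ℝ) 1) →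
        (Nat.factorial k : ℝ) ≤ ∫ x in (-0.9 : ℝ)..(0.9 : ℝ), iteratedDeriv k f x →
        1 / c ^ k ≤ sSup ((fun x => |f x|) '' Set.Icc (-1 : ℝ) 1) := by
  refine ⟨20 * Real.exp 1, by positivity, ?_⟩
  intro k hk f hf hinf hint
  obtain ⟨m, rfl⟩ : ∃ m, k = m + 1 := ⟨k - 1, by omega⟩
  set M := sSup ((fun x => |f x|) '' Set.Icc (-1 : ℝ) 1) with hMdef
  have hfc : Continuous f := by
    have := (hf 0 (by omega)).continuous
    simpa using this
  have hM : ∀ x ∈ Icc (-1 : ℝ) 1, |f x| ≤ M := fun x hx =>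
    le_csSup (isCompact_Icc.image hfc.abs).bddAbove (mem_image_of_mem _ hx)
  have hD : ∀ i < m + 1, ∀ t,
      HasDerivAt (iteratedDeriv i f) (iteratedDeriv (i+1) f t) t := by
    intro i hi t
    rw [iteratedDeriv_succ]
    exact (hf i hi t).hasDerivAt
  have hbdd : BddBelow ((iteratedDeriv (m+1) f) '' Set.Icc (-1 : ℝ) 1) := by
    by_contra hb
    rw [Real.sInf_of_not_bddBelow hb] at hinf
    exact lt_irrefl _ hinf
  have hpos : ∀ x ∈ Icc (-1 : ℝ) 1, 0 < iteratedDeriv (m+1) f x := fun x hx =>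
    hinf.trans_le (csInf_le hbdd (mem_image_of_mem _ hx))
  have hmono : MonotoneOn (iteratedDeriv m f) (Icc (-1 : ℝ) 1) := by
    apply monotoneOn_of_deriv_nonneg (convex_Icc _ _)
      (hf m (by omega)).continuous.continuousOn (hf m (by omega)).differentiableOn
    intro x hx
    rw [← iteratedDeriv_succ]
    exact (hpos x (interior_subset hx)).le
  have hfac : (0 : ℝ) < ((m+1).factorial : ℝ) := by exact_mod_cast Nat.factorial_pos _
  have hii : IntervalIntegrable (iteratedDeriv (m+1) f) MeasureTheory.volume (-0.9) 0.9 := by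
    by_contra h
    rw [intervalIntegral.integral_undef h] at hint
    linarith
  rw [intervalIntegral.integral_eq_sub_of_hasDerivAt
    (fun x _ => hD m (by omega) x) hii] at hint
  have hm0 : (0 : ℝ) < m + 1 := by positivity
  set h : ℝ := 0.1 / (m + 1) with hh
  have hhpos : 0 < h := by positivity
  have hmh : m * h ≤ 0.1 := by
    have : (m + 1) * h = 0.1 := by rw [hh]; field_simp
    linarith
  have h1 := fd_aux m (fun i => iteratedDeriv i f) 0.9 h (iteratedDeriv m f 0.9) M hhpos.le
    (fun i hi t => hD i (by omega) t)
    (fun t ht => hmono (by constructor <;> norm_num)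
      ⟨by linarith [ht.1], by linarith [ht.2]⟩ ht.1)
    (fun t ht => by
      simpa using hM t ⟨by linarith [ht.1], by linarith [ht.2]⟩)
  have h2 := fd_aux m (fun i t => - iteratedDeriv i f t) (-1) h (-iteratedDeriv m f (-0.9)) M
    hhpos.le
    (fun i hi t => (hD i (by omega) t).neg)
    (fun t ht => neg_le_neg (hmono ⟨by linarith [ht.1], by linarith [ht.2]⟩
      (by constructor <;> norm_num) (by linarith [ht.2])))
    (fun t ht => by
      simpa using hM t ⟨by linarith [ht.1], by linarith [ht.2]⟩)
  have hM0 : 0 ≤ M := (abs_nonneg _).trans (hM 0 (by simp))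
  have h3 : ((m+1).factorial : ℝ) * h ^ m ≤ 2 * (2 ^ m * M) := by
    have := mul_le_mul_of_nonneg_right hint (pow_nonneg hhpos.le m)
    linarith
  have hexp := Real.pow_div_factorial_le_exp ((m : ℝ) + 1) hm0.le (m + 1)
  rw [div_le_iff₀ hfac] at hexp
  have h4 : ((m+1).factorial : ℝ) * h ^ (m+1) ≤ 2 ^ (m+1) * M := by
    have hle : h ≤ 1 := by
      rw [hh, div_le_one hm0]; linarith [Nat.cast_nonneg (α := ℝ) m]
    calc ((m+1).factorial : ℝ) * h ^ (m+1) = (((m+1).factorial : ℝ) * h ^ m) * h := by ring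
      _ ≤ (((m+1).factorial : ℝ) * h ^ m) * 1 := by gcongr
      _ ≤ 2 * (2 ^ m * M) := by linarith
      _ = _ := by ring
  have h5 : ((m+1).factorial : ℝ) ≤ 20 ^ (m+1) * ((m:ℝ)+1) ^ (m+1) * M := by
    have e : (10 * ((m:ℝ)+1)) ^ (m+1) * h ^ (m+1) = 1 := by
      rw [← mul_pow]
      have : 10 * ((m:ℝ)+1) * h = 1 := by rw [hh]; field_simp; norm_num
      rw [this, one_pow]
    calc ((m+1).factorial : ℝ)
        = (10 * ((m:ℝ)+1)) ^ (m+1) * (((m+1).factorial : ℝ) * h ^ (m+1)) := by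
          linear_combination (-((m+1).factorial : ℝ)) * e
      _ ≤ (10 * ((m:ℝ)+1)) ^ (m+1) * (2 ^ (m+1) * M) := by gcongr
      _ = (10 * 2) ^ (m+1) * ((m:ℝ)+1) ^ (m+1) * M := by rw [mul_pow, mul_pow]; ring
      _ = _ := by norm_num
  have h6 : ((m+1).factorial : ℝ) * 1 ≤
      ((m+1).factorial : ℝ) * ((20 * Real.exp 1) ^ (m+1) * M) := by
    have e : Real.exp ((m:ℝ)+1) = Real.exp 1 ^ (m+1) := by
      rw [← Real.exp_nat_mul]; simp
    calc ((m+1).factorial : ℝ) * 1 ≤ 20 ^ (m+1) * ((m:ℝ)+1) ^ (m+1) * M := by linarith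
      _ ≤ 20 ^ (m+1) * (Real.exp ((m:ℝ)+1) * ((m+1).factorial : ℝ)) * M := by gcongr
      _ = _ := by rw [e, mul_pow]; ring
  have h7 := le_of_mul_le_mul_left h6 hfac
  rw [div_le_iff₀ (by positivity)]
  linarith
end

section
/- Fix k ∈ ℕ and let x_j = cos((k−j)π/k) for j = 0, 1, …, k be the k+1 extremal points of the degree-k Chebyshev polynomial of the first kind T_k on [−1,1]. Then for every a > 0 and every polynomial P of degree k with leading coefficient a, max_{0 ≤ j ≤ k} |P(x_j)| ≥ a·2^{1−k}; moreover the polynomial a·2^{1−k}·T_k attains this bound: max_{0 ≤ j ≤ k} |a·2^{1−k}·T_k(x_j)| = a·2^{1−k}. -/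
open Real Polynomial

open Polynomial.Chebyshev in
lemma coeff_nodes {n : ℕ} {P : ℝ[X]} (hP : P.degree ≤ n) :
    P.coeff n = ∑ i ∈ Finset.range (n + 1), P.eval (node n i) *
      (∏ j ∈ (Finset.range (n + 1)).erase i, (node n i - node n j))⁻¹ := by
  have : P.degree < (Finset.range (n + 1)).card := by
    rw [Finset.card_range]
    grw [hP]
    norm_cast
    simp
  have h := Lagrange.coeff_eq_sum (strictAntiOn_node n).injOn this
  simpa [div_eq_mul_inv] using h

open Polynomial.Chebyshev in
lemma coeff_le_nodes {n : ℕ} {P : ℝ[X]} (hP : P.degree ≤ n) (M : ℝ)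
    (hM : ∀ i ≤ n, |P.eval (node n i)| ≤ M) : P.coeff n ≤ M * 2 ^ (n - 1) := by
  have hT : (T ℝ n).coeff n = 2 ^ (n - 1) := by
    trans (T ℝ n).leadingCoeff
    · simp [leadingCoeff]
    · simp
  rw [← hT, coeff_nodes hP, coeff_nodes (P := T ℝ n) (by simp), Finset.mul_sum]
  refine Finset.sum_le_sum fun i hi => ?_
  have hi' : i ≤ n := Finset.mem_range_succ_iff.mp hi
  rw [eval_T_real_node (Finset.mem_Iic.mpr hi')]
  have hc := inv_pos_of_pos <| zero_lt_prod_node_sub_node hi'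
  rw [mul_inv, ← inv_pow, inv_neg_one] at hc
  have hb := abs_le.mp (hM i hi')
  rcases neg_one_pow_eq_or ℝ i with h | h <;> rw [h] at hc ⊢ <;> nlinarith

/-- **Extremality of Chebyshev polynomials on the Chebyshev extremal points.**
Fix `k ≥ 1` and let `x_j = cos((k-j)π/k)`, `j = 0, …, k`, be the extremal points of the
degree-`k` Chebyshev polynomial `T_k` on `[-1,1]`. For every `a > 0` and every polynomial `P`
of degree `k` with leading coefficient `a`, `max_j |P(x_j)| ≥ a·2^{1-k}`, and the polynomial
`a·2^{1-k}·T_k` attains this bound: `max_j |a·2^{1-k}·T_k(x_j)| = a·2^{1-k}`. -/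
theorem statement11 (k : ℕ) (hk : 1 ≤ k) (x : ℕ → ℝ)
    (hx : ∀ j ≤ k, x j = Real.cos (((k : ℝ) - j) * Real.pi / k)) :
    (∀ a : ℝ, 0 < a → ∀ P : Polynomial ℝ, P.degree = k → P.leadingCoeff = a →
      a * (2 : ℝ) ^ ((1 : ℤ) - (k : ℤ)) ≤
        (Finset.range (k + 1)).sup' (Finset.nonempty_range_iff.mpr (Nat.succ_ne_zero k))
          (fun j => |P.eval (x j)|)) ∧
    (∀ a : ℝ, 0 < a →
      (Finset.range (k + 1)).sup' (Finset.nonempty_range_iff.mpr (Nat.succ_ne_zero k))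
          (fun j => |(a * (2 : ℝ) ^ ((1 : ℤ) - (k : ℤ))) *
            (Polynomial.Chebyshev.T ℝ (k : ℤ)).eval (x j)|)
        = a * (2 : ℝ) ^ ((1 : ℤ) - (k : ℤ))) := by
  have hk0 : (k : ℝ) ≠ 0 := by positivity
  have hz : (2 : ℝ) ^ ((1 : ℤ) - (k : ℤ)) = (2 ^ (k - 1))⁻¹ := by
    rw [← zpow_natCast, ← zpow_neg]
    congr 1
    omega
  have hnode : ∀ j ≤ k, x j = Polynomial.Chebyshev.node k (k - j) := by
    intro j hj
    rw [hx j hj, Polynomial.Chebyshev.node, Nat.cast_sub hj]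
  refine ⟨fun a ha P hP hPa => ?_, fun a ha => ?_⟩
  · have h := coeff_le_nodes (n := k) (P := P) hP.le
      ((Finset.range (k + 1)).sup' (Finset.nonempty_range_iff.mpr (Nat.succ_ne_zero k))
          (fun j => |P.eval (x j)|)) (by
        intro i hi
        have h1 := Finset.le_sup' (fun j => |P.eval (x j)|)
          (Finset.mem_range.mpr (show k - i < k + 1 by omega))
        have h2 := hnode (k - i) (by omega)
        rw [Nat.sub_sub_self hi] at h2
        rw [← h2]
        exact h1)
    rw [leadingCoeff, natDegree_eq_of_degree_eq_some hP] at hPa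
    rw [hPa] at h
    rw [hz, ← div_eq_mul_inv, div_le_iff₀ (by positivity)]
    exact h
  · have hpos : 0 < a * (2 : ℝ) ^ ((1 : ℤ) - (k : ℤ)) := by positivity
    have key : ∀ j ∈ Finset.range (k + 1), |(a * (2 : ℝ) ^ ((1 : ℤ) - (k : ℤ))) *
            (Polynomial.Chebyshev.T ℝ (k : ℤ)).eval (x j)| =
            a * (2 : ℝ) ^ ((1 : ℤ) - (k : ℤ)) := by
      intro j hj
      rw [hnode j (Finset.mem_range_succ_iff.mp hj),
        Polynomial.Chebyshev.eval_T_real_node (Finset.mem_Iic.mpr (Nat.sub_le k j)),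
        abs_mul, abs_neg_one_pow, mul_one, abs_of_pos hpos]
    rw [Finset.sup'_congr _ rfl key, Finset.sup'_const]
end

section
/- There exists a universal constant K > 0 such that the following holds. Let f be a Gaussian stationary process on ℝ with spectral measure ρ satisfying m₂ = m₂(ρ) < ∞, set m₀ = ρ(ℝ) > 0 and a = √(m₂/(4m₀)). Then for all N > 1: E[sup_{t ∈ [0,N]} f(t)] ≤ K·√(m₀ · max{log(aN), 1}). -/
open MeasureTheory ProbabilityTheory Real Set
open scoped ENNReal NNReal

noncomputable section

theorem max_bound {Ω : Type} [MeasurableSpace Ω] (P : Measure Ω) [IsProbabilityMeasure P]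
    (m : ℕ) (hm : 1 ≤ m) (X : ℕ → Ω → ℝ) (hX : ∀ j, Measurable (X j)) (s L : ℝ) (hs : 0 < s) (hL : 0 < L)
    (hmL : (2 * m : ℝ) ≤ exp L)
    (hg : ∀ j, ∃ v : ℝ≥0, (v : ℝ) ≤ s ^ 2 ∧ P.map (X j) = gaussianReal 0 v) :
    ∃ B : Ω → ℝ≥0∞, Measurable B ∧ (∀ j < m, ∀ ω, ENNReal.ofReal |X j ω| ≤ B ω) ∧
      ∫⁻ ω, B ω ∂P ≤ ENNReal.ofReal (s * √(2 * L)) := by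
  set l : ℝ := √(2 * L) / s with hl
  have hlpos : 0 < l := by positivity
  set c : ℝ := exp L * exp (s ^ 2 * l ^ 2 / 2) with hc
  have hcpos : 0 < c := by positivity
  set Y : Ω → ℝ := fun ω => ∑ j ∈ Finset.range m, (exp (l * X j ω) + exp (-l * X j ω)) with hY
  have hint : ∀ j, ∀ u : ℝ, Integrable (fun ω => exp (u * X j ω)) P ∧ 
      ∫ ω, exp (u * X j ω) ∂P ≤ exp (s ^ 2 * u ^ 2 / 2) := by
    intro j u
    obtain ⟨v, hv, hmap⟩ := hg j
    constructor
    · have h := integrable_exp_mul_gaussianReal (μ := 0) (v := v) u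
      rw [← hmap] at h
      exact (integrable_map_measure (by fun_prop) (hX j).aemeasurable).1 h
    · have := mgf_gaussianReal hmap u
      rw [mgf] at this
      rw [this]
      apply exp_le_exp.2
      have := mul_le_mul_of_nonneg_right hv (sq_nonneg u)
      linarith
  have hYint : Integrable Y P := by
    apply integrable_finsetSum
    intro j _
    exact (hint j l).1.add (hint j (-l)).1
  have hYle : ∫ ω, Y ω ∂P ≤ c := by
    rw [hY]
    simp only
    rw [integral_finsetSum]
    · calc _ ≤ ∑ j ∈ Finset.range m, 2 * exp (s ^ 2 * l ^ 2 / 2) := by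
            apply Finset.sum_le_sum
            intro j _
            rw [integral_add (hint j l).1 (hint j (-l)).1]
            have h1 := (hint j l).2
            have h2 := (hint j (-l)).2
            rw [neg_sq] at h2
            linarith
        _ = (2 * m) * exp (s ^ 2 * l ^ 2 / 2) := by simp; ring
        _ ≤ c := by rw [hc]; gcongr
    · intro j _
      exact (hint j l).1.add (hint j (-l)).1
  set Z : Ω → ℝ := fun ω => 1 / l * (log c - 1 + 1 / c * Y ω) with hZ
  have hZle : ∀ j < m, ∀ ω, |X j ω| ≤ Z ω := by
    intro j hj ω
    have h1 : exp (l * |X j ω|) ≤ Y ω := by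
      have : exp (l * |X j ω|) ≤ exp (l * X j ω) + exp (-l * X j ω) := by
        rcases abs_cases (X j ω) with ⟨h, _⟩ | ⟨h, _⟩ <;> rw [h]
        · linarith [exp_pos (-l * X j ω)]
        · rw [mul_neg, ← neg_mul]; linarith [exp_pos (l * X j ω)]
      refine this.trans ?_
      exact Finset.single_le_sum (f := fun j => exp (l * X j ω) + exp (-l * X j ω)) (fun i _ => by positivity) (Finset.mem_range.2 hj)
    have h2 : l * |X j ω| - log c + 1 ≤ exp (l * |X j ω|) / c := by
      have := add_one_le_exp (l * |X j ω| - log c)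
      rwa [exp_sub, exp_log hcpos] at this
    have h3 : exp (l * |X j ω|) / c ≤ Y ω / c := by gcongr
    rw [hZ]
    simp only
    rw [div_mul_eq_mul_div, le_div_iff₀ hlpos]
    have : 1 / c * Y ω = Y ω / c := by ring
    rw [this]; linarith
  refine ⟨fun ω => ENNReal.ofReal (Z ω), ?_, fun j hj ω => ENNReal.ofReal_le_ofReal (hZle j hj ω), ?_⟩
  · have : Measurable Y := by fun_prop
    fun_prop
  · have hZint : Integrable Z P := ((integrable_const _).add (hYint.const_mul _)).const_mul _
    rw [← ofReal_integral_eq_lintegral_ofReal hZint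
      (ae_of_all _ fun ω => (abs_nonneg _).trans (hZle 0 hm ω))]
    apply ENNReal.ofReal_le_ofReal
    have : ∫ ω, Z ω ∂P = 1 / l * (log c - 1 + 1 / c * ∫ ω, Y ω ∂P) := by
      rw [hZ, integral_const_mul, integral_add (integrable_const _) (hYint.const_mul _), integral_const_mul]
      simp
    rw [this]
    have h1 : 1 / c * ∫ ω, Y ω ∂P ≤ 1 := by
      rw [div_mul_eq_mul_div, div_le_one hcpos]; linarith
    have h2 : log c = 2 * L := by
      rw [hc, log_mul (by positivity) (by positivity), log_exp, log_exp, hl, div_pow, sq_sqrt (by positivity)]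
      field_simp; ring
    calc _ ≤ 1 / l * (2 * L) := by gcongr; linarith
      _ = s * √(2 * L) := by
        rw [hl]
        have := sq_sqrt (show 0 ≤ 2 * L by positivity)
        have h0 : 0 < √(2 * L) := by positivity
        field_simp
        linarith

theorem integral_le_aux {Ω : Type} [MeasurableSpace Ω] (P : Measure Ω) (S : Ω → ℝ) (C : ℝ) (hC : 0 ≤ C)
    (h : ∫⁻ ω, ENNReal.ofReal (S ω) ∂P ≤ ENNReal.ofReal C) : ∫ ω, S ω ∂P ≤ C := by
  by_cases hS : Integrable S P
  · rw [integral_eq_lintegral_pos_part_sub_lintegral_neg_part hS]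
    have := ENNReal.toReal_mono ENNReal.ofReal_ne_top h
    rw [ENNReal.toReal_ofReal hC] at this
    linarith [ENNReal.toReal_nonneg (a := ∫⁻ ω, ENNReal.ofReal (-S ω) ∂P)]
  · rwa [integral_undef hS]

/-- deterministic chaining -/
theorem chain_bound (g : ℝ → ℝ) (hg : Continuous g) (N : ℝ) (hN : 0 < N) (n : ℕ) (hn : 1 ≤ n)
    (A : ℝ≥0∞) (B : ℕ → ℝ≥0∞)
    (hA : ∀ j < n + 1, ENNReal.ofReal |g (j * (N / n))| ≤ A)
    (hB : ∀ k, ∀ j < n * 2 ^ k, ENNReal.ofReal |g ((2 * j + 1 : ℕ) * (N / (n * 2 ^ (k+1)))) -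
        g ((2 * j : ℕ) * (N / (n * 2 ^ (k+1))))| ≤ B k)
    (t : ℝ) (ht : t ∈ Icc 0 N) : ENNReal.ofReal (g t) ≤ A + ∑' k, B k := by
  have hn0 : (0:ℝ) < n := by exact_mod_cast hn
  set J : ℕ → ℕ := fun k => ⌊t * (n * 2 ^ k) / N⌋₊ with hJ
  set T : ℕ → ℝ := fun k => J k * (N / (n * 2 ^ k)) with hT
  have hx : ∀ k, 0 ≤ t * (n * 2 ^ k) / N := fun k => div_nonneg (mul_nonneg ht.1 (by positivity)) hN.le
  have hJle : ∀ k, J k ≤ n * 2 ^ k := by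
    intro k
    have h1 : ((J k : ℕ) : ℝ) ≤ t * (n * 2 ^ k) / N := Nat.floor_le (hx k)
    have h2 : t * (n * 2 ^ k) / N ≤ n * 2 ^ k := by
      rw [div_le_iff₀ hN, mul_comm]; gcongr; exact ht.2
    exact_mod_cast h1.trans h2
  have hstep : ∀ k, J (k+1) = 2 * J k ∨ J (k+1) = 2 * J k + 1 := by
    intro k
    have e : t * (n * 2 ^ (k+1)) / N = 2 * (t * (n * 2 ^ k) / N) := by ring
    have a1 : ((J k : ℕ) : ℝ) ≤ t * (n * 2 ^ k) / N := Nat.floor_le (hx k)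
    have a2 : t * (n * 2 ^ k) / N < J k + 1 := Nat.lt_floor_add_one _
    have b1 : ((J (k+1) : ℕ) : ℝ) ≤ t * (n * 2 ^ (k+1)) / N := Nat.floor_le (hx _)
    have b2 : t * (n * 2 ^ (k+1)) / N < J (k+1) + 1 := Nat.lt_floor_add_one _
    rw [e] at b1 b2
    have c1 : ((J (k+1) : ℕ) : ℝ) < 2 * J k + 2 := by linarith
    have c2 : (2 * J k : ℝ) < J (k+1) + 1 := by linarith
    have c1' : J (k+1) < 2 * J k + 2 := by exact_mod_cast c1
    have c2' : 2 * J k < J (k+1) + 1 := by exact_mod_cast c2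
    omega
  have hTe : ∀ k, T k = (2 * J k : ℕ) * (N / (n * 2 ^ (k+1))) := by
    intro k; simp only [hT]; push_cast; rw [pow_succ]; field_simp
  have hbd : ∀ k, ENNReal.ofReal |g (T k)| ≤ A + ∑ i ∈ Finset.range k, B i := by
    intro k
    induction k with
    | zero =>
      have := hA (J 0) (by have := hJle 0; simp at this; omega)
      simpa [hT] using this
    | succ k ih =>
      rw [Finset.sum_range_succ, ← add_assoc]
      have hd : ENNReal.ofReal |g (T (k+1)) - g (T k)| ≤ B k := by
        rcases hstep k with h | h
        · have : T (k+1) = T k := by rw [hTe k]; simp only [hT, h]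
          simp [this]
        · have hlt : J k < n * 2 ^ k := by
            have := hJle (k+1)
            rw [pow_succ, h] at this
            by_contra! hh
            nlinarith
          have := hB k (J k) hlt
          rw [← hTe k, ← h] at this
          exact this
      calc ENNReal.ofReal |g (T (k+1))| ≤ ENNReal.ofReal (|g (T k)| + |g (T (k+1)) - g (T k)|) := by
            apply ENNReal.ofReal_le_ofReal
            have := abs_add_le (g (T k)) (g (T (k+1)) - g (T k))
            rwa [add_sub_cancel] at this
        _ = _ := ENNReal.ofReal_add (abs_nonneg _) (abs_nonneg _)
        _ ≤ _ := add_le_add ih hd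
  have hlim : Filter.Tendsto T Filter.atTop (nhds t) := by
    have hz : Filter.Tendsto (fun k : ℕ => t - N / n * (1/2:ℝ) ^ k) Filter.atTop (nhds t) := by
      have := (tendsto_pow_atTop_nhds_zero_of_lt_one (r := (1/2:ℝ)) (by norm_num) (by norm_num)).const_mul (N / n)
      simpa using this.const_sub t
    refine tendsto_of_tendsto_of_tendsto_of_le_of_le hz tendsto_const_nhds ?_ ?_
    · intro k
      have a2 : t * (n * 2 ^ k) / N < J k + 1 := Nat.lt_floor_add_one _
      have : t ≤ (J k + 1) * (N / (n * 2 ^ k)) := by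
        have := mul_le_mul_of_nonneg_right a2.le (show 0 ≤ N / (n * 2 ^ k) by positivity)
        refine le_trans (le_of_eq ?_) this
        field_simp
      simp only [hT]
      have e : N / n * (1/2:ℝ) ^ k = N / (n * 2 ^ k) := by rw [one_div, inv_pow]; field_simp
      rw [e]; linarith
    · intro k
      have a1 : ((J k : ℕ) : ℝ) ≤ t * (n * 2 ^ k) / N := Nat.floor_le (hx k)
      have := mul_le_mul_of_nonneg_right a1 (show 0 ≤ N / (n * 2 ^ k) by positivity)
      refine le_trans this (le_of_eq ?_)
      field_simp
  have hl2 : Filter.Tendsto (fun k => ENNReal.ofReal (g (T k))) Filter.atTop (nhds (ENNReal.ofReal (g t))) :=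
    ENNReal.tendsto_ofReal ((hg.tendsto t).comp hlim)
  refine le_of_tendsto' hl2 fun k => ?_
  refine (ENNReal.ofReal_le_ofReal (le_abs_self _)).trans ((hbd k).trans ?_)
  gcongr
  exact ENNReal.sum_le_tsum _

theorem var_incr (ρ : Measure ℝ) [IsFiniteMeasure ρ] (h2 : ∫⁻ l, (ENNReal.ofReal |l|) ^ (2:ℝ) ∂ρ < ⊤) (d : ℝ) :
    2 * (ρ univ).toReal - 2 * ∫ l, cos (l * d) ∂ρ ≤ (∫⁻ l, (ENNReal.ofReal |l|) ^ (2:ℝ) ∂ρ).toReal * d ^ 2 := by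
  have e : ∀ l : ℝ, (ENNReal.ofReal |l|) ^ (2:ℝ) = ENNReal.ofReal (l ^ 2) := by
    intro l
    rw [ENNReal.ofReal_rpow_of_nonneg (abs_nonneg l) (by norm_num)]
    simp
  simp only [e] at h2 ⊢
  have hi : Integrable (fun l : ℝ => l ^ 2) ρ := by
    refine ⟨by fun_prop, ?_⟩
    rw [hasFiniteIntegral_iff_ofReal (ae_of_all _ fun l => sq_nonneg l)]
    exact h2
  rw [← integral_eq_lintegral_of_nonneg_ae (ae_of_all _ fun l => sq_nonneg l) (by fun_prop)]
  have hcos : Integrable (fun l : ℝ => cos (l * d)) ρ := by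
    refine Integrable.mono' (integrable_const (1:ℝ)) (by fun_prop) (ae_of_all _ fun l => ?_)
    exact abs_cos_le_one _
  have : ∫ l, (1 - (l ^ 2 * d ^ 2 / 2)) ∂ρ ≤ ∫ l, cos (l * d) ∂ρ := by
    apply integral_mono ((integrable_const _).sub ((hi.mul_const _).div_const _)) hcos
    intro l
    have := one_sub_sq_div_two_le_cos (x := l * d)
    rw [mul_pow] at this
    exact this
  rw [integral_sub (integrable_const _) ((hi.mul_const _).div_const _), integral_div, integral_mul_const] at this
  simp [Measure.real] at this
  linarith

/-- **Expected supremum of a GSP.** There is a universal `K > 0` such that for any GSP `f`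
on `ℝ` with `m₂ < ∞` and `m₀ = ρ(ℝ) > 0`, setting `a = √(m₂/(4m₀))`, one has for all
`N > 1`: `E[sup_{[0,N]} f] ≤ K·√(m₀·max{log(aN), 1})`. -/
theorem statement17 :
    ∃ K : ℝ, 0 < K ∧
      ∀ (Ω : Type) (_ : MeasurableSpace Ω) (P : Measure Ω) (ρ : Measure ℝ)
        (f : ℝ → Ω → ℝ), IsGSPR ρ P f →
        0 < (ρ Set.univ).toReal → specMom ρ 2 < ⊤ →
        ∀ N : ℝ, 1 < N →
          ∫ ω, (⨆ t : Set.Icc (0:ℝ) N, f (t : ℝ) ω) ∂P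
            ≤ K * Real.sqrt ((ρ Set.univ).toReal *
                max (Real.log (Real.sqrt ((specMom ρ 2).toReal /
                  (4 * (ρ Set.univ).toReal)) * N)) 1) := by
  refine ⟨5 * √8, by positivity, ?_⟩
  intro Ω _ P ρ f hf hm0 hm2 N hN
  obtain ⟨hfin, -, hprob, hmeas, hcont, hgau⟩ := hf
  set m0 : ℝ := (ρ univ).toReal with hm0def
  set m2 : ℝ := (specMom ρ 2).toReal with hm2def
  have hm2nn : 0 ≤ m2 := ENNReal.toReal_nonneg
  set a : ℝ := √(m2 / (4 * m0)) with ha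
  have ha0 : 0 ≤ a := sqrt_nonneg _
  set M : ℝ := max (log (a * N)) 1 with hM
  have hM1 : 1 ≤ M := le_max_right _ _
  have hN0 : 0 < N := by linarith
  have haN : a * N ≤ exp M := by
    rcases (mul_nonneg ha0 hN0.le).eq_or_lt with h | h
    · rw [← h]; positivity
    · rw [← exp_log h]; exact exp_le_exp.2 (le_max_left _ _)
  set n : ℕ := ⌈a * N⌉₊ + 1 with hn
  have hn1 : 1 ≤ n := by omega
  have hn0 : (0:ℝ) < n := by exact_mod_cast hn1
  have hnl : a * N ≤ n := by
    have := Nat.le_ceil (a * N)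
    rw [hn]; push_cast; linarith
  have hnu : (n:ℝ) ≤ a * N + 2 := by
    have := Nat.ceil_lt_add_one (mul_nonneg ha0 hN0.le)
    rw [hn]; push_cast; linarith
  have heM : 1 ≤ exp M := one_le_exp (by linarith)
  have he2 : (2:ℝ) ≤ exp 1 := by linarith [add_one_le_exp (1:ℝ)]
  have hpow : ∀ k : ℕ, (2:ℝ) ^ k ≤ exp k := by
    intro k
    calc (2:ℝ) ^ k ≤ exp 1 ^ k := by gcongr
      _ = exp k := by rw [← exp_nat_mul, mul_one]
  have hfm : ∀ t, Measurable (f t) := fun t => hmeas.comp (measurable_const.prodMk measurable_id)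
  -- marginals
  have hmarg : ∀ t, P.map (f t) = gaussianReal 0 m0.toNNReal := by
    intro t
    have := hgau 1 (fun _ => t) (fun _ => 1)
    simpa [Measure.real, hm0def] using this
  have hinc : ∀ t u, P.map (fun ω => f t ω - f u ω)
      = gaussianReal 0 (2 * m0 - 2 * ∫ l, cos (l * (t - u)) ∂ρ).toNNReal := by
    intro t u
    have := hgau 2 ![t, u] ![1, -1]
    have e : ∫ l, cos (l * (u - t)) ∂ρ = ∫ l, cos (l * (t - u)) ∂ρ := by
      congr 1; ext l; rw [← cos_neg]; congr 1; ring
    simp [Fin.sum_univ_two, Measure.real, e] at this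
    simp only [sub_eq_add_neg]
    rw [this]
    congr 2
    simp only [sub_eq_add_neg]
    ring
  -- base level
  obtain ⟨A, hAm, hA, hAi⟩ := max_bound P (n + 1) (by omega) (fun j => f (j * (N / n)))
    (fun j => hfm _) (√m0) (4 * M) (by positivity) (by positivity)
    (by
      have h3 : (8:ℝ) ≤ exp (3:ℕ) := by have := hpow 3; norm_num at this ⊢; exact this
      push_cast at h3 ⊢
      calc 2 * ((n:ℝ) + 1) ≤ 8 * exp M := by linarith
        _ ≤ exp 3 * exp M := by gcongr
        _ = exp (3 + M) := (exp_add _ _).symm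
        _ ≤ exp (4 * M) := exp_le_exp.2 (by linarith))
    (fun j => ⟨m0.toNNReal, by rw [sq_sqrt hm0.le, Real.coe_toNNReal _ hm0.le], hmarg _⟩)
  have hlev : ∀ k : ℕ, ∃ B : Ω → ℝ≥0∞, Measurable B ∧ (∀ j < n * 2 ^ k, ∀ ω,
      ENNReal.ofReal |f ((2 * j + 1 : ℕ) * (N / (n * 2 ^ (k+1)))) ω -
        f ((2 * j : ℕ) * (N / (n * 2 ^ (k+1)))) ω| ≤ B ω) ∧
      ∫⁻ ω, B ω ∂P ≤ ENNReal.ofReal (√m0 * √(8 * M) * (3/4) ^ k) := by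
    intro k
    have hexp : (k:ℝ) + 1 ≤ (9/4) ^ k := by
      have := one_add_mul_le_pow (show (-2:ℝ) ≤ 5/4 by norm_num) k
      norm_num at this
      have hk : (0:ℝ) ≤ k := by positivity
      linarith
    obtain ⟨B, hBm, hB, hBi⟩ := max_bound P (n * 2 ^ k) (Nat.mul_pos hn1 (by positivity))
      (fun j ω => f ((2 * j + 1 : ℕ) * (N / (n * 2 ^ (k+1)))) ω -
        f ((2 * j : ℕ) * (N / (n * 2 ^ (k+1)))) ω)
      (fun j => (hfm _).sub (hfm _)) (√m0 * (1/2) ^ k) (4 * M * (9/4) ^ k)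
      (by positivity) (by positivity)
      (by
        have h3 : (8:ℝ) ≤ exp (3:ℕ) := by have := hpow 3; norm_num at this ⊢; exact this
        push_cast at h3 ⊢
        have hk : (0:ℝ) ≤ k := by positivity
        calc 2 * ((n:ℝ) * 2 ^ k) ≤ 8 * exp M * 2 ^ k := by
              have : 2 * (n:ℝ) ≤ 8 * exp M := by linarith
              have := mul_le_mul_of_nonneg_right this (show (0:ℝ) ≤ 2 ^ k by positivity)
              linarith
          _ ≤ exp 3 * exp M * exp k := by gcongr; exact hpow k
          _ = exp (3 + M + k) := by rw [exp_add, exp_add]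
          _ ≤ exp (4 * M * (9/4) ^ k) := exp_le_exp.2 (by
              have h1 : 4 * M * (k + 1) ≤ 4 * M * (9/4) ^ k := by gcongr
              nlinarith))
      (by
        intro j
        refine ⟨_, ?_, hinc _ _⟩
        have hd : ((2 * j + 1 : ℕ) : ℝ) * (N / (n * 2 ^ (k+1))) - (2 * j : ℕ) * (N / (n * 2 ^ (k+1)))
          = N / (n * 2 ^ (k+1)) := by push_cast; ring
        rw [hd]
        have hv := var_incr ρ hm2 (N / (n * 2 ^ (k+1)))
        rw [Real.coe_toNNReal']
        refine max_le (hv.trans ?_) (by positivity)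
        change m2 * _ ≤ _
        have h4 : m2 = 4 * m0 * a ^ 2 := by
          rw [ha, sq_sqrt (by positivity)]; field_simp
        have h5 : a ^ 2 * N ^ 2 ≤ (n:ℝ) ^ 2 := by
          rw [← mul_pow]; gcongr
        rw [mul_pow, sq_sqrt hm0.le, h4]
        have h6 : 4 * m0 * a ^ 2 * (N / (n * 2 ^ (k+1))) ^ 2
          = m0 * ((1/2) ^ k) ^ 2 * ((a ^ 2 * N ^ 2) / (n:ℝ) ^ 2) := by
          rw [one_div, inv_pow, pow_succ]; field_simp; ring
        rw [h6]
        exact mul_le_of_le_one_right (by positivity) ((div_le_one (by positivity)).2 h5))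
    refine ⟨B, hBm, hB, hBi.trans (le_of_eq ?_)⟩
    congr 1
    have e1 : 2 * (4 * M * (9/4:ℝ) ^ k) = 8 * M * ((3/2) ^ k) ^ 2 := by
      rw [← pow_mul, mul_comm k 2, pow_mul]; norm_num; ring
    rw [e1, sqrt_mul (by positivity), sqrt_sq (by positivity)]
    have e2 : (3/4:ℝ) ^ k = (1/2) ^ k * (3/2) ^ k := by rw [← mul_pow]; norm_num
    rw [e2]; ring
  choose B hBm hB hBi using hlev
  apply integral_le_aux _ _ _ (by positivity)
  calc ∫⁻ ω, ENNReal.ofReal (⨆ t : Icc (0:ℝ) N, f (t:ℝ) ω) ∂P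
      ≤ ∫⁻ ω, (A ω + ∑' k, B k ω) ∂P := by
        apply lintegral_mono_ae
        filter_upwards [hcont] with ω hω
        have hc := chain_bound (fun t => f t ω) hω N hN0 n hn1 (A ω) (fun k => B k ω)
          (fun j hj => hA j hj ω) (fun k j hj => hB k j hj ω)
        by_cases htop : A ω + ∑' k, B k ω = ⊤
        · rw [htop]; exact le_top
        · rw [ENNReal.ofReal_le_iff_le_toReal htop]
          apply Real.iSup_le _ ENNReal.toReal_nonneg
          intro t
          exact (ENNReal.ofReal_le_iff_le_toReal htop).1 (hc t t.2)
    _ = ∫⁻ ω, A ω ∂P + ∑' k, ∫⁻ ω, B k ω ∂P := by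
        rw [lintegral_add_left hAm, lintegral_tsum fun k => (hBm k).aemeasurable]
    _ ≤ ENNReal.ofReal (√m0 * √(8 * M)) + ∑' k : ℕ, ENNReal.ofReal (√m0 * √(8 * M) * (3/4) ^ k) := by
        gcongr with k
        · refine hAi.trans (le_of_eq ?_)
          congr 3; ring
        · exact hBi k
    _ = ENNReal.ofReal (5 * √8 * √(m0 * M)) := by
        have hs : HasSum (fun k : ℕ => √m0 * √(8 * M) * (3/4:ℝ) ^ k) (√m0 * √(8 * M) * 4) := by
          have := (hasSum_geometric_of_lt_one (r := (3/4:ℝ)) (by norm_num) (by norm_num)).mul_left (√m0 * √(8 * M))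
          norm_num at this ⊢
          exact this
        rw [← ENNReal.ofReal_tsum_of_nonneg (fun k => by positivity) hs.summable, hs.tsum_eq,
          ← ENNReal.ofReal_add (by positivity) (by positivity)]
        congr 1
        rw [sqrt_mul (by norm_num : (0:ℝ) ≤ 8), sqrt_mul hm0.le]
        ring

end
end
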